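/- Suppose [·,·] is a Lie bracket on ℝ^7 and Λ : ℝ^7 → 𝔤𝔩(7,ℝ) is a linear map with Λ(x)y − Λ(y)x = [x,y] and Λ(x) ∈ 𝔤₂* for all x,y ∈ ℝ^7, and suppose the infinitesimal holonomy 𝔥 equals 𝔞 ⋉ 𝔪(1,0,k), one of the listed type III algebras, with 𝔞 ≠ 0. Then (i) Λ(x) ∈ 𝔥^III for all x ∈ ℝ^7, and (ii) the subalgebra span{e_1,e_2,e_3} is abelian, i.e. [e_i,e_j] = 0 for all i,j ∈ {1,2,3}. -/

import Mathlib

open Matrix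

noncomputable section

abbrev V7 : Type := Fin 7 → ℝ
abbrev M7 : Type := Matrix (Fin 7) (Fin 7) ℝ
abbrev M2 : Type := Matrix (Fin 2) (Fin 2) ℝ

/-- The standard basis of `ℝ^7` (0-indexed: `e 0` is `e_1` of the paper). -/
def e (i : Fin 7) : V7 := Pi.single i 1

/-- The matrix `X(s)` (indices shifted: `s 0 = s_1`, …, `s 13 = s_14`). -/
def Xg2 (s : Fin 14 → ℝ) : M7 :=
  !![s 0 + s 3, -s 9, s 8, Real.sqrt 2 * s 5, 0, -s 10, -s 11;
     -s 7, s 0, s 1, Real.sqrt 2 * s 8, s 10, 0, s 5;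
     s 6, s 2, s 3, Real.sqrt 2 * s 9, s 11, -s 5, 0;
     Real.sqrt 2 * s 4, Real.sqrt 2 * s 6, Real.sqrt 2 * s 7, 0,
       Real.sqrt 2 * s 5, Real.sqrt 2 * s 8, Real.sqrt 2 * s 9;
     0, s 12, s 13, Real.sqrt 2 * s 4, -s 0 - s 3, s 7, -s 6;
     -s 12, 0, -s 4, Real.sqrt 2 * s 6, s 9, -s 0, -s 2;
     -s 13, s 4, 0, Real.sqrt 2 * s 7, -s 8, -s 1, -s 3]

/-- `𝔤₂* = {X(s) : s ∈ ℝ^14}`. -/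
def g2star : Set M7 := Set.range Xg2

/-- The matrix `h(A,v,u,y)`. -/
def hmat (A : M2) (v : ℝ) (u y : Fin 2 → ℝ) : M7 :=
  !![A 0 0 + A 1 1, -u 1, u 0, Real.sqrt 2 * v, 0, -y 0, -y 1;
     0, A 0 0, A 0 1, Real.sqrt 2 * u 0, y 0, 0, v;
     0, A 1 0, A 1 1, Real.sqrt 2 * u 1, y 1, -v, 0;
     0, 0, 0, 0, Real.sqrt 2 * v, Real.sqrt 2 * u 0, Real.sqrt 2 * u 1;
     0, 0, 0, 0, -(A 0 0 + A 1 1), 0, 0;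
     0, 0, 0, 0, u 1, -A 0 0, -A 1 0;
     0, 0, 0, 0, -u 0, -A 0 1, -A 1 1]

/-- `𝔥^I = {h(A,v,u,y)}`. -/
def hI : Set M7 := {X | ∃ A v u y, X = hmat A v u y}

/-- The matrix `h(A,v,y) := h(A,v,0,y)`. -/
def h3 (A : M2) (v : ℝ) (y : Fin 2 → ℝ) : M7 := hmat A v 0 y

/-- `𝔥^III = {h(A,v,y)}`. -/
def hIII : Set M7 := {X | ∃ A v y, X = h3 A v y}

/-- `𝔪(1,0,1) = {h(0,v,(y_1,0))}`. -/
def m101 : Set M7 := {X | ∃ v y1, X = h3 0 v ![y1, 0]}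

/-- `𝔪(1,0,2) = {h(0,v,(y_1,y_2))}`. -/
def m102 : Set M7 := {X | ∃ v y, X = h3 0 v y}

/-- The curvature `R(x,y) = Λ(x)Λ(y) − Λ(y)Λ(x) − Λ([x,y])`. -/
def curv (L : V7 →ₗ[ℝ] M7) (bk : V7 → V7 → V7) (x y : V7) : M7 :=
  L x * L y - L y * L x - L (bk x y)

/-- The infinitesimal holonomy: the smallest linear subspace of `𝔤𝔩(7,ℝ)` containing
all `R(x,y)` and stable under bracketing with all `Λ(z)`. -/
def infHol (L : V7 →ₗ[ℝ] M7) (bk : V7 → V7 → V7) : Submodule ℝ M7 :=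
  sInf {H : Submodule ℝ M7 | (∀ x y, curv L bk x y ∈ H) ∧
    ∀ z : V7, ∀ X ∈ H, L z * X - X * L z ∈ H}

/-- `𝔰𝔩(2,ℝ)` as a set of 2×2 matrices. -/
def sl2 : Set M2 := {A | A 0 0 + A 1 1 = 0}

/-- `𝔤𝔩(2,ℝ)` as a set of 2×2 matrices. -/
def gl2 : Set M2 := Set.univ

/-- `𝔠𝔬(2) = {(a,−b;b,a)}`. -/
def co2 : Set M2 := {A | ∃ a b : ℝ, A = !![a, -b; b, a]}

/-- `𝔡`, the diagonal 2×2 matrices. -/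
def dd : Set M2 := {A | A 0 1 = 0 ∧ A 1 0 = 0}

/-- `ℝ·diag(1,0)`. -/
def rdiag10 : Set M2 := {A | ∃ t : ℝ, A = !![t, 0; 0, 0]}

/-- `𝔞 ⋉ 𝔪(1,0,k)`. -/
def semidir (a : Set M2) : ℕ → Set M7
  | 1 => {X | ∃ A ∈ a, ∃ v y1, X = h3 A v ![y1, 0]}
  | _ => {X | ∃ A ∈ a, ∃ v y, X = h3 A v y}

/-- The pairs `(𝔞, k)` occurring in the list of type III holonomy algebras. -/
def ListedPair (a : Set M2) (k : ℕ) : Prop :=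
  ((a = sl2 ∨ a = gl2 ∨ a = co2 ∨ a = dd) ∧ k = 2) ∨
  ((a = ({0} : Set M2) ∨ a = rdiag10) ∧ (k = 1 ∨ k = 2))

/-- The listed type III holonomy algebras `𝔞 ⋉ 𝔪(1,0,k)`. -/
def ListedTypeIII (S : Set M7) : Prop := ∃ a k, ListedPair a k ∧ S = semidir a k

/-- The torsion-free bracket `Λ(x)y − Λ(y)x`. -/
def lieBr (L : V7 →ₗ[ℝ] M7) (x y : V7) : V7 := (L x).mulVec y - (L y).mulVec x

/-- The Jacobi identity of the bracket determined by `L`. -/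
def Jacobi (L : V7 →ₗ[ℝ] M7) : Prop :=
  ∀ x y z, lieBr L (lieBr L x y) z + lieBr L (lieBr L y z) x + lieBr L (lieBr L z x) y = 0

theorem curv_bianchi (L : V7 →ₗ[ℝ] M7) (hjac : Jacobi L) (x y z : V7) :
    (curv L (lieBr L) x y).mulVec z + (curv L (lieBr L) y z).mulVec x
      + (curv L (lieBr L) z x).mulVec y = 0 := by
  have h := hjac x y z
  have key : ∀ x y z : V7, (curv L (lieBr L) x y).mulVec z =
      (L x).mulVec ((L y).mulVec z) - (L y).mulVec ((L x).mulVec z)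
        - (lieBr L (lieBr L x y) z + (L z).mulVec ((L x).mulVec y - (L y).mulVec x)) := by
    intro x y z
    simp only [curv, lieBr, Matrix.sub_mulVec, Matrix.mulVec_mulVec]
    abel
  rw [key x y z, key y z x, key z x y]
  simp only [Matrix.mulVec_sub]
  rw [← neg_eq_zero, ← h]
  abel

/-- The components of a matrix in `𝔥^III`, read off from its entries. -/
theorem eq_h3_of_mem {X : M7} (h : X ∈ hIII) :
    X = h3 !![X 1 1, X 1 2; X 2 1, X 2 2] (X 1 6) ![X 1 4, X 2 4] := by
  obtain ⟨A, v, y, rfl⟩ := h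
  simp [h3, hmat]

theorem lieBr_antisymm (L : V7 →ₗ[ℝ] M7) (x y : V7) : lieBr L x y = - lieBr L y x := by
  simp [lieBr]

theorem curv_antisymm (L : V7 →ₗ[ℝ] M7) (x y : V7) :
    curv L (lieBr L) x y = - curv L (lieBr L) y x := by
  rw [curv, curv, lieBr_antisymm, map_neg]; abel

theorem lieBr_basis (L : V7 →ₗ[ℝ] M7) (i j : Fin 7) :
    lieBr L (e i) (e j) = ∑ m, (L (e i) m j - L (e j) m i) • e m := by
  ext m; simp [lieBr, e, Finset.sum_apply, Pi.single_apply]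

theorem curv_basis (L : V7 →ₗ[ℝ] M7) (i j : Fin 7) :
    curv L (lieBr L) (e i) (e j) = L (e i) * L (e j) - L (e j) * L (e i)
      - ∑ m, (L (e i) m j - L (e j) m i) • L (e m) := by
  rw [curv, lieBr_basis, map_sum]
  simp only [map_smul]

theorem curv_add_left (L : V7 →ₗ[ℝ] M7) (x x' y : V7) :
    curv L (lieBr L) (x + x') y = curv L (lieBr L) x y + curv L (lieBr L) x' y := by
  simp only [curv, lieBr, map_add, map_sub, Matrix.add_mulVec, Matrix.mulVec_add, add_mul, mul_add]
  abel

theorem curv_smul_left (L : V7 →ₗ[ℝ] M7) (c : ℝ) (x y : V7) :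
    curv L (lieBr L) (c • x) y = c • curv L (lieBr L) x y := by
  simp only [curv, lieBr, map_smul, map_sub, Matrix.smul_mulVec, Matrix.mulVec_smul,
    smul_mul_assoc, mul_smul_comm, smul_sub]

/-- The curvature as a linear map in its first argument. -/
def curvLeft (L : V7 →ₗ[ℝ] M7) (y : V7) : V7 →ₗ[ℝ] M7 where
  toFun x := curv L (lieBr L) x y
  map_add' x x' := curv_add_left L x x' y
  map_smul' c x := curv_smul_left L c x y

theorem curv_lieBr_basis (L : V7 →ₗ[ℝ] M7) (i j : Fin 7) (z : V7) :
    curv L (lieBr L) (lieBr L (e i) (e j)) z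
      = ∑ m, (L (e i) m j - L (e j) m i) • curv L (lieBr L) (e m) z := by
  rw [lieBr_basis]
  exact (map_sum (curvLeft L z) _ _).trans (by simp only [map_smul]; rfl)

set_option maxHeartbeats 2000000 in
theorem h3_comm {A B : M2} {v w : ℝ} {y z : Fin 2 → ℝ} :
    h3 A v y * h3 B w z - h3 B w z * h3 A v y
      = h3 (A * B - B * A) (A.trace * w - B.trace * v)
        (A *ᵥ z + A.trace • z - B *ᵥ y - B.trace • y) := by
  ext i j
  simp only [Matrix.sub_apply, Matrix.mul_apply, Fin.sum_univ_seven]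
  fin_cases i <;> fin_cases j <;>
    simp [h3, hmat, Matrix.mul_apply, Matrix.trace, Fin.sum_univ_two, vecHead, vecTail] <;> ring

/-- `𝔥^III` as a linear subspace. -/
def hIIIsub : Submodule ℝ M7 where
  carrier := hIII
  zero_mem' := ⟨0, 0, 0, by ext i j; fin_cases i <;> fin_cases j <;> simp [h3, hmat]⟩
  add_mem' := by
    rintro _ _ ⟨A, v, y, rfl⟩ ⟨B, w, z, rfl⟩
    refine ⟨A + B, v + w, y + z, ?_⟩
    ext i j; fin_cases i <;> fin_cases j <;> simp [h3, hmat] <;> ring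
  smul_mem' := by
    rintro c _ ⟨A, v, y, rfl⟩
    refine ⟨c • A, c * v, c • y, ?_⟩
    ext i j; fin_cases i <;> fin_cases j <;> simp [h3, hmat] <;> ring

theorem comm_mem_hIII {X Y : M7} (hX : X ∈ hIII) (hY : Y ∈ hIII) : X * Y - Y * X ∈ hIII := by
  obtain ⟨A, v, y, rfl⟩ := hX
  obtain ⟨B, w, z, rfl⟩ := hY
  exact ⟨_, _, _, h3_comm⟩

theorem curv_mem_hIII {L : V7 →ₗ[ℝ] M7} (hL : ∀ x, L x ∈ hIII) (x y : V7) :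
    curv L (lieBr L) x y ∈ hIII :=
  hIIIsub.sub_mem (comm_mem_hIII (hL x) (hL y)) (hL _)

/-- The curvature on basis vectors. -/
def cv (L : V7 →ₗ[ℝ] M7) (i j : Fin 7) : M7 := curv L (lieBr L) (e i) (e j)

theorem second_bianchi_zero {L : V7 →ₗ[ℝ] M7} (hL : ∀ x, L x ∈ hIII) (hjac : Jacobi L)
    (x y z : V7) :
    curv L (lieBr L) (lieBr L x y) z 0 0 + curv L (lieBr L) (lieBr L y z) x 0 0
      + curv L (lieBr L) (lieBr L z x) y 0 0 = 0 := by
  have key : ∀ a b, curv L (lieBr L) a b 0 0 = - L (lieBr L a b) 0 0 := by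
    intro a b
    rw [curv, Matrix.sub_apply, eq_h3_of_mem (hL a), eq_h3_of_mem (hL b), h3_comm]
    simp [h3, hmat]
    ring
  rw [key, key, key]
  have h := congrArg (fun w => L w 0 0) (hjac x y z)
  simp only [map_add, Matrix.add_apply, map_zero, Matrix.zero_apply] at h
  linarith

theorem second_bianchi_v {L : V7 →ₗ[ℝ] M7} (hL : ∀ x, L x ∈ hIII) (hjac : Jacobi L)
    (x y z : V7) :
    curv L (lieBr L) (lieBr L x y) z 1 6 + curv L (lieBr L) (lieBr L y z) x 1 6
      + curv L (lieBr L) (lieBr L z x) y 1 6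
      = L z 0 0 * curv L (lieBr L) x y 1 6 - curv L (lieBr L) x y 0 0 * L z 1 6
      + (L x 0 0 * curv L (lieBr L) y z 1 6 - curv L (lieBr L) y z 0 0 * L x 1 6)
      + (L y 0 0 * curv L (lieBr L) z x 1 6 - curv L (lieBr L) z x 0 0 * L y 1 6) := by
  have key : ∀ a b, curv L (lieBr L) a b 0 0 = - L (lieBr L a b) 0 0 := by
    intro a b
    rw [curv, Matrix.sub_apply, eq_h3_of_mem (hL a), eq_h3_of_mem (hL b), h3_comm]
    simp [h3, hmat]
    ring
  have tr : ∀ a, L a 0 0 = L a 1 1 + L a 2 2 := by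
    intro a
    rw [eq_h3_of_mem (hL a)]; simp [h3, hmat]
  have kv : ∀ a b, curv L (lieBr L) a b 1 6 = L a 0 0 * L b 1 6 - L b 0 0 * L a 1 6
      - L (lieBr L a b) 1 6 := by
    intro a b
    rw [tr a, tr b, curv, Matrix.sub_apply]
    conv_lhs => rw [eq_h3_of_mem (hL a), eq_h3_of_mem (hL b), h3_comm]
    simp [h3, hmat]
  have h := congrArg (fun w => L w 1 6) (hjac x y z)
  simp only [map_add, Matrix.add_apply, map_zero, Matrix.zero_apply] at h
  simp only [key, kv]
  linear_combination -h

/-- The linear consequences of the first Bianchi identity for a curvature tensor with values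
in `𝔥^III`. -/
structure BianchiLinear (P Q G S V : Fin 7 → Fin 7 → ℝ) : Prop where
  antiP : ∀ i j, P i j = - P j i
  antiQ : ∀ i j, Q i j = - Q j i
  antiG : ∀ i j, G i j = - G j i
  antiS : ∀ i j, S i j = - S j i
  antiV : ∀ i j, V i j = - V j i
  flat : ∀ i j, i ≠ 5 → i ≠ 6 → j ≠ 5 → j ≠ 6 → P i j = 0 ∧ Q i j = 0 ∧ G i j = 0 ∧ S i j = 0
  vanT : ∀ i j, i ≠ 4 → j ≠ 4 → P i j + S i j = 0
  vanV : ∀ i j, i ≠ 4 → j ≠ 4 → V i j = 0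
  vanV4 : ∀ i, i ≠ 4 → i ≠ 5 → i ≠ 6 → V i 4 = 0
  flat56 : P 5 6 = 0 ∧ Q 5 6 = 0 ∧ G 5 6 = 0 ∧ S 5 6 = 0
  sym : ∀ i, i ≠ 5 → i ≠ 6 → P i 6 = G i 5 ∧ S i 5 = Q i 6
  sym12 : P 2 5 = Q 1 5 ∧ G 2 5 = S 1 5 ∧ P 2 6 = Q 1 6 ∧ G 2 6 = S 1 6
  flatnull : ∀ i j, i = 0 ∨ i = 3 → j = 5 ∨ j = 6 → P i j = 0 ∧ Q i j = 0 ∧ G i j = 0 ∧ S i j = 0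

theorem bianchi_linear (P Q G S V Y U : Fin 7 → Fin 7 → ℝ)
    (R : Fin 7 → Fin 7 → M7)
    (hR : ∀ i j, R i j = h3 !![P i j, Q i j; G i j, S i j] (V i j) ![Y i j, U i j])
    (anti : ∀ i j, R i j = - R j i)
    (b : ∀ i j k m, R i j m k + R j k m i + R k i m j = 0) :
    BianchiLinear P Q G S V := by
  have h2 : √2 ≠ 0 := by positivity
  have aP : ∀ i j, P i j = - P j i := fun i j => by
    simpa [hR, h3, hmat] using congrFun (congrFun (anti i j) 1) 1
  have aQ : ∀ i j, Q i j = - Q j i := fun i j => by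
    simpa [hR, h3, hmat] using congrFun (congrFun (anti i j) 1) 2
  have aG : ∀ i j, G i j = - G j i := fun i j => by
    simpa [hR, h3, hmat] using congrFun (congrFun (anti i j) 2) 1
  have aS : ∀ i j, S i j = - S j i := fun i j => by
    simpa [hR, h3, hmat] using congrFun (congrFun (anti i j) 2) 2
  have aV : ∀ i j, V i j = - V j i := fun i j => by
    simpa [hR, h3, hmat] using congrFun (congrFun (anti i j) 1) 6
  have aY : ∀ i j, Y i j = - Y j i := fun i j => by
    simpa [hR, h3, hmat] using congrFun (congrFun (anti i j) 1) 4
  have aU : ∀ i j, U i j = - U j i := fun i j => by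
    simpa [hR, h3, hmat] using congrFun (congrFun (anti i j) 2) 4
  have e0 : ∀ i j, R i j 0 = ![P i j + S i j, 0, 0, √2 * V i j, 0, - Y i j, - U i j] := by
    intro i j; rw [hR]; ext m; fin_cases m <;> simp [h3, hmat]
  have e1 : ∀ i j, R i j 1 = ![0, P i j, Q i j, 0, Y i j, 0, V i j] := by
    intro i j; rw [hR]; ext m; fin_cases m <;> simp [h3, hmat]
  have e2 : ∀ i j, R i j 2 = ![0, G i j, S i j, 0, U i j, -V i j, 0] := by
    intro i j; rw [hR]; ext m; fin_cases m <;> simp [h3, hmat]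
  have e3 : ∀ i j, R i j 3 = ![0, 0, 0, 0, √2 * V i j, 0, 0] := by
    intro i j; rw [hR]; ext m; fin_cases m <;> simp [h3, hmat]
  have e4 : ∀ i j, R i j 4 = ![0, 0, 0, 0, -S i j + -P i j, 0, 0] := by
    intro i j; rw [hR]; ext m; fin_cases m <;> simp [h3, hmat]
  have e5 : ∀ i j, R i j 5 = ![0, 0, 0, 0, 0, -P i j, -G i j] := by
    intro i j; rw [hR]; ext m; fin_cases m <;> simp [h3, hmat]
  have e6 : ∀ i j, R i j 6 = ![0, 0, 0, 0, 0, -Q i j, -S i j] := by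
    intro i j; rw [hR]; ext m; fin_cases m <;> simp [h3, hmat]
  have r3 : ∀ a b i, i ≠ 4 → R a b 3 i = 0 := by
    intro a b i hi; rw [e3]; fin_cases i <;> first | exact absurd rfl hi | simp
  have r4 : ∀ a b i, i ≠ 4 → R a b 4 i = 0 := by
    intro a b i hi; rw [e4]; fin_cases i <;> first | exact absurd rfl hi | simp
  have r5 : ∀ a b i, i ≠ 5 → i ≠ 6 → R a b 5 i = 0 := by
    intro a b i hi hi'; rw [e5]
    fin_cases i <;> first | exact absurd rfl hi | exact absurd rfl hi' | simp
  have r6 : ∀ a b i, i ≠ 5 → i ≠ 6 → R a b 6 i = 0 := by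
    intro a b i hi hi'; rw [e6]
    fin_cases i <;> first | exact absurd rfl hi | exact absurd rfl hi' | simp
  have tr : ∀ i j, i ≠ 4 → j ≠ 4 → P i j + S i j = 0 := by
    intro i j hi hj
    have h := b i j 4 4
    rw [r4 _ _ _ hi, r4 _ _ _ hj, e4] at h
    simp at h; linarith
  have v : ∀ i j, i ≠ 4 → j ≠ 4 → V i j = 0 := by
    intro i j hi hj
    have h := b i j 4 3
    rw [r3 _ _ _ hi, r3 _ _ _ hj, e3] at h
    simpa using h
  have flat : ∀ i j, i ≠ 5 → i ≠ 6 → j ≠ 5 → j ≠ 6 →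
      P i j = 0 ∧ Q i j = 0 ∧ G i j = 0 ∧ S i j = 0 := by
    intro i j hi hi' hj hj'
    have h1 := b i j 5 5
    have h2 := b i j 6 5
    have h3 := b i j 5 6
    have h4 := b i j 6 6
    rw [r5 _ _ _ hi hi', r5 _ _ _ hj hj', e5] at h1 h2
    rw [r6 _ _ _ hi hi', r6 _ _ _ hj hj', e6] at h3 h4
    simp at h1 h2 h3 h4
    exact ⟨h1, h3, h2, h4⟩
  have sym : ∀ i, i ≠ 5 → i ≠ 6 → P i 6 = G i 5 ∧ S i 5 = Q i 6 := by
    intro i hi hi'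
    have h1 := b i 5 6 5
    have h2 := b i 5 6 6
    rw [r5 _ _ _ hi hi', e5, e5] at h1
    rw [r6 _ _ _ hi hi', e6, e6] at h2
    simp [aP 6 i, aQ 6 i] at h1 h2
    exact ⟨by linarith, by linarith⟩
  have flat56 : P 5 6 = 0 ∧ Q 5 6 = 0 ∧ G 5 6 = 0 ∧ S 5 6 = 0 := by
    have h1 := b 5 6 1 1
    have h2 := b 5 6 2 1
    have h3 := b 5 6 1 2
    have h4 := b 5 6 2 2
    simp [e1, e2, v 1 5, v 6 2, v 6 1, v 2 5] at h1 h2 h3 h4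
    exact ⟨h1, h2, h3, h4⟩
  refine ⟨aP, aQ, aG, aS, aV, flat, tr, v, ?_, flat56, sym, ?_, ?_⟩
  · intro i h4 h5 h6
    have x1 := b i 4 6 1
    have x2 := b i 4 5 2
    have x3 := b i 5 6 0
    have x4 := (sym 4 (by decide) (by decide))
    have x5 := tr 5 6 (by decide) (by decide)
    have x6 := v 5 6 (by decide) (by decide)
    rw [e1, e1, e1] at x1
    rw [e2, e2, e2] at x2
    rw [e0, e0, e0] at x3
    fin_cases i <;>
      first
      | exact absurd rfl h4
      | exact absurd rfl h5
      | exact absurd rfl h6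
      | (simp [x5, x6] at x1 x2 x3 ⊢
         linarith [aY 6 0, aU 5 0, aY 6 1, aU 5 1, aY 6 2, aU 5 2, aY 6 3, aU 5 3])
  · have h1 := b 1 2 5 1
    have h2 := b 1 2 5 2
    have h3 := b 1 2 6 1
    have h4 := b 1 2 6 2
    simp [e1, e2, v 1 2, aQ 5 1, aS 5 1, aQ 6 1, aS 6 1] at h1 h2 h3 h4
    exact ⟨by linarith, by linarith, by linarith, by linarith⟩
  · rintro i j hi hj
    have h1 := b i 1 j 1
    have h2 := b i 1 j 2
    have h3 := b i 2 j 1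
    have h4 := b i 2 j 2
    have w1 : V i 1 = 0 := v i 1 (by rcases hi with rfl | rfl <;> decide) (by decide)
    have w2 : V i 2 = 0 := v i 2 (by rcases hi with rfl | rfl <;> decide) (by decide)
    rw [aP i j, aQ i j, aG i j, aS i j]
    rw [e1, e1, e1] at h1 h3
    rw [e2, e2, e2] at h2 h4
    rcases hi with rfl | rfl <;> rcases hj with rfl | rfl <;>
      simp [w1, w2] at h1 h2 h3 h4 ⊢ <;> exact ⟨h1, h3, h2, h4⟩

/-- The structure constants determined by the components of `L`. -/
def struc (p q g s v y u : Fin 7 → ℝ) (i j m : Fin 7) : ℝ :=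
  h3 !![p i, q i; g i, s i] (v i) ![y i, u i] m j - h3 !![p j, q j; g j, s j] (v j) ![y j, u j] m i

/-- The component equations of a torsion-free connection with values in `𝔥^III`:
`p, q, g, s, v, y, u` are the components of `Λ` and `P, Q, G, S, V` those of the curvature. -/
structure CurvEqs (p q g s v y u : Fin 7 → ℝ) (P Q G S V : Fin 7 → Fin 7 → ℝ) : Prop
    extends BianchiLinear P Q G S V where
  eP : ∀ i j, P i j = q i * g j - q j * g i - ∑ m, struc p q g s v y u i j m * p m
  eQ : ∀ i j, Q i j = p i * q j + q i * s j - p j * q i - q j * s i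
    - ∑ m, struc p q g s v y u i j m * q m
  eG : ∀ i j, G i j = g i * p j + s i * g j - g j * p i - s j * g i
    - ∑ m, struc p q g s v y u i j m * g m
  eS : ∀ i j, S i j = g i * q j - g j * q i - ∑ m, struc p q g s v y u i j m * s m
  eV : ∀ i j, V i j = (p i + s i) * v j - (p j + s j) * v i
    - ∑ m, struc p q g s v y u i j m * v m
  secondT : ∀ i j k, (∑ m, struc p q g s v y u i j m * (P m k + S m k))
    + (∑ m, struc p q g s v y u j k m * (P m i + S m i))
    + (∑ m, struc p q g s v y u k i m * (P m j + S m j)) = 0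
  secondV : ∀ i j k, (∑ m, struc p q g s v y u i j m * V m k)
    + (∑ m, struc p q g s v y u j k m * V m i)
    + (∑ m, struc p q g s v y u k i m * V m j)
    = (p k + s k) * V i j - (P i j + S i j) * v k
      + ((p i + s i) * V j k - (P j k + S j k) * v i)
      + ((p j + s j) * V k i - (P k i + S k i) * v j)

theorem curvEqs {L : V7 →ₗ[ℝ] M7} (hL : ∀ x, L x ∈ hIII) (hjac : Jacobi L) :
    CurvEqs (fun z => L (e z) 1 1) (fun z => L (e z) 1 2) (fun z => L (e z) 2 1)
      (fun z => L (e z) 2 2) (fun z => L (e z) 1 6) (fun z => L (e z) 1 4) (fun z => L (e z) 2 4)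
      (fun i j => cv L i j 1 1) (fun i j => cv L i j 1 2) (fun i j => cv L i j 2 1)
      (fun i j => cv L i j 2 2) (fun i j => cv L i j 1 6) := by
  have hc : ∀ x y, curv L (lieBr L) x y ∈ hIII := curv_mem_hIII hL
  have hs : ∀ i j m, struc (fun z => L (e z) 1 1) (fun z => L (e z) 1 2) (fun z => L (e z) 2 1)
      (fun z => L (e z) 2 2) (fun z => L (e z) 1 6) (fun z => L (e z) 1 4) (fun z => L (e z) 2 4)
      i j m = L (e i) m j - L (e j) m i := by
    intro i j m
    rw [struc, ← eq_h3_of_mem (hL _), ← eq_h3_of_mem (hL _)]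
  have tr : ∀ X : M7, X ∈ hIII → X 0 0 = X 1 1 + X 2 2 := by
    rintro _ ⟨A, w, z, rfl⟩; simp [h3, hmat]
  have hcv : ∀ i j, cv L i j = h3 (!![L (e i) 1 1, L (e i) 1 2; L (e i) 2 1, L (e i) 2 2]
      * !![L (e j) 1 1, L (e j) 1 2; L (e j) 2 1, L (e j) 2 2]
      - !![L (e j) 1 1, L (e j) 1 2; L (e j) 2 1, L (e j) 2 2]
      * !![L (e i) 1 1, L (e i) 1 2; L (e i) 2 1, L (e i) 2 2])
      ((L (e i) 1 1 + L (e i) 2 2) * L (e j) 1 6 - (L (e j) 1 1 + L (e j) 2 2) * L (e i) 1 6)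
      (!![L (e i) 1 1, L (e i) 1 2; L (e i) 2 1, L (e i) 2 2] *ᵥ ![L (e j) 1 4, L (e j) 2 4]
        + (L (e i) 1 1 + L (e i) 2 2) • ![L (e j) 1 4, L (e j) 2 4]
        - !![L (e j) 1 1, L (e j) 1 2; L (e j) 2 1, L (e j) 2 2] *ᵥ ![L (e i) 1 4, L (e i) 2 4]
        - (L (e j) 1 1 + L (e j) 2 2) • ![L (e i) 1 4, L (e i) 2 4])
      - ∑ m, (L (e i) m j - L (e j) m i) • L (e m) := by
    intro i j
    have hh := @h3_comm !![L (e i) 1 1, L (e i) 1 2; L (e i) 2 1, L (e i) 2 2]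
      !![L (e j) 1 1, L (e j) 1 2; L (e j) 2 1, L (e j) 2 2] (L (e i) 1 6) (L (e j) 1 6)
      ![L (e i) 1 4, L (e i) 2 4] ![L (e j) 1 4, L (e j) 2 4]
    rw [← eq_h3_of_mem (hL _), ← eq_h3_of_mem (hL _)] at hh
    rw [cv, curv_basis, hh]
    simp [Matrix.trace, Fin.sum_univ_two]
  refine { bianchi_linear _ _ _ _ _ (fun i j => cv L i j 1 4) (fun i j => cv L i j 2 4) (cv L)
      (fun i j => eq_h3_of_mem (hc _ _)) (fun i j => curv_antisymm L _ _) ?_ with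
      eP := ?_, eQ := ?_, eG := ?_, eS := ?_, eV := ?_, secondT := ?_, secondV := ?_ }
  · intro i j k m
    have := congrFun (curv_bianchi L hjac (e i) (e j) (e k)) m
    simpa [e, cv] using this
  · intro i j
    simp only [hs]
    rw [hcv]
    simp [h3, hmat, Matrix.sum_apply]
    ring
  · intro i j
    simp only [hs]
    rw [hcv]
    simp [h3, hmat, Matrix.sum_apply]
    ring
  · intro i j
    simp only [hs]
    rw [hcv]
    simp [h3, hmat, Matrix.sum_apply]
    ring
  · intro i j
    simp only [hs]
    rw [hcv]
    simp [h3, hmat, Matrix.sum_apply]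
    ring
  · intro i j
    simp only [hs]
    rw [hcv]
    simp [h3, hmat, Matrix.sum_apply]
  · intro i j k
    have h := second_bianchi_zero hL hjac (e i) (e j) (e k)
    simp only [curv_lieBr_basis, Matrix.sum_apply, Matrix.smul_apply, smul_eq_mul,
      fun a b => tr _ (hc a b)] at h
    simp only [hs, cv, mul_add, Finset.sum_add_distrib] at h ⊢
    linarith
  · intro i j k
    have h := second_bianchi_v hL hjac (e i) (e j) (e k)
    simp only [curv_lieBr_basis, Matrix.sum_apply, Matrix.smul_apply, smul_eq_mul,
      fun a b => tr _ (hc a b), fun a => tr _ (hL a)] at h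
    simp only [hs, cv] at h ⊢
    linarith

theorem eq_of_lt_four {w : Fin 7} (hw : w.val < 4) : w = 0 ∨ w = 1 ∨ w = 2 ∨ w = 3 := by
  revert w; decide

theorem CurvEqs.ricci_form {p q g s v y u : Fin 7 → ℝ} {P Q G S V : Fin 7 → Fin 7 → ℝ}
    (H : CurvEqs p q g s v y u P Q G S V) (w : Fin 7) (hw : w.val < 4) :
    (2 * p w + s w) * (P 4 5 + S 4 5) + q w * (P 4 6 + S 4 6) = 0 ∧
    g w * (P 4 5 + S 4 5) + (p w + 2 * s w) * (P 4 6 + S 4 6) = 0 := by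
  have h5 := H.secondT w 4 5
  have h6 := H.secondT w 4 6
  have t : ∀ i j, i ≠ 4 → j ≠ 4 → P i j + S i j = 0 := H.vanT
  have f : ∀ i j, i ≠ 5 → i ≠ 6 → j ≠ 5 → j ≠ 6 → P i j + S i j = 0 := fun i j a b c d => by
    obtain ⟨h1, -, -, h4⟩ := H.flat i j a b c d
    rw [h1, h4, add_zero]
  have a5 : P 5 4 + S 5 4 = - (P 4 5 + S 4 5) := by rw [H.antiP, H.antiS]; ring
  have a6 : P 6 4 + S 6 4 = - (P 4 6 + S 4 6) := by rw [H.antiP, H.antiS]; ring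
  have tw : w ≠ 4 ∧ w ≠ 5 ∧ w ≠ 6 := by
    refine ⟨?_, ?_, ?_⟩ <;> rintro rfl <;> simp at hw
  simp only [Fin.sum_univ_seven, t 0 5, t 1 5, t 2 5, t 3 5, t 5 5, t 6 5, t 0 6, t 1 6,
    t 2 6, t 3 6, t 5 6, t 6 6, f 0 4, f 1 4, f 2 4, f 3 4, f 4 4, a5, a6, t 0 w, t 1 w,
    t 2 w, t 3 w, t 5 w, t 6 w, f 4 w, tw, ne_eq, not_false_eq_true, mul_zero,
    add_zero, zero_add, Fin.reduceEq] at h5 h6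
  constructor
  · have : struc p q g s v y u w 4 4 = -(p w + s w) ∧ struc p q g s v y u 5 w 5 = p w ∧
      struc p q g s v y u 5 w 6 = q w := by
      rcases eq_of_lt_four hw with rfl | rfl | rfl | rfl <;> simp [struc, h3, hmat]
    rw [this.1, this.2.1, this.2.2] at h5
    linarith
  · have : struc p q g s v y u w 4 4 = -(p w + s w) ∧ struc p q g s v y u 6 w 5 = g w ∧
      struc p q g s v y u 6 w 6 = s w := by
      rcases eq_of_lt_four hw with rfl | rfl | rfl | rfl <;> simp [struc, h3, hmat]
    rw [this.1, this.2.1, this.2.2] at h6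
    linarith

theorem CurvEqs.sigma_form {p q g s v y u : Fin 7 → ℝ} {P Q G S V : Fin 7 → Fin 7 → ℝ}
    (H : CurvEqs p q g s v y u P Q G S V) (w : Fin 7) (hw : w.val < 4) :
    (3 * p w + 2 * s w) * V 4 5 + q w * V 4 6 = v w * (P 4 5 + S 4 5) ∧
    g w * V 4 5 + (2 * p w + 3 * s w) * V 4 6 = v w * (P 4 6 + S 4 6) := by
  have h5 := H.secondV w 4 5
  have h6 := H.secondV w 4 6
  have t : ∀ i j, i ≠ 4 → j ≠ 4 → V i j = 0 := H.vanV
  have t' : ∀ i j, i ≠ 4 → j ≠ 4 → P i j + S i j = 0 := H.vanT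
  have f : ∀ i, i ≠ 4 → i ≠ 5 → i ≠ 6 → V i 4 = 0 := H.vanV4
  have f' : ∀ i, i ≠ 4 → i ≠ 5 → i ≠ 6 → V 4 i = 0 := fun i a b c => by
    rw [H.antiV, f i a b c, neg_zero]
  have f44 : V 4 4 = 0 := by linarith [H.antiV 4 4]
  have tw : w ≠ 4 ∧ w ≠ 5 ∧ w ≠ 6 := by
    refine ⟨?_, ?_, ?_⟩ <;> rintro rfl <;> simp at hw
  have z : P w 4 + S w 4 = 0 := by
    obtain ⟨h1, -, -, h4⟩ := H.flat w 4 tw.2.1 tw.2.2 (by decide) (by decide)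
    rw [h1, h4, add_zero]
  simp only [Fin.sum_univ_seven, t 0 5, t 1 5, t 2 5, t 3 5, t 5 5, t 6 5, t 0 6, t 1 6,
    t 2 6, t 3 6, t 5 6, t 6 6, f 0, f 1, f 2, f 3, f w, f' w, f44, H.antiV 5 4, H.antiV 6 4,
    t 0 w, t' 5 w, t' 6 w, z,
    t 1 w, t 2 w, t 3 w, t 5 w, t 6 w, tw, ne_eq, not_false_eq_true, mul_zero,
    add_zero, zero_add, Fin.reduceEq, zero_mul, sub_zero] at h5 h6
  constructor
  · have : struc p q g s v y u w 4 4 = -(p w + s w) ∧ struc p q g s v y u 5 w 5 = p w ∧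
      struc p q g s v y u 5 w 6 = q w := by
      rcases eq_of_lt_four hw with rfl | rfl | rfl | rfl <;> simp [struc, h3, hmat]
    rw [this.1, this.2.1, this.2.2] at h5
    linarith
  · have : struc p q g s v y u w 4 4 = -(p w + s w) ∧ struc p q g s v y u 6 w 5 = g w ∧
      struc p q g s v y u 6 w 6 = s w := by
      rcases eq_of_lt_four hw with rfl | rfl | rfl | rfl <;> simp [struc, h3, hmat]
    rw [this.1, this.2.1, this.2.2] at h6
    linarith

section

/-- The pairing of a covector `F` with `Λ(e_i) e_j`. -/
def act (p q g s v y u F : Fin 7 → ℝ) (i j : Fin 7) : ℝ :=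
  ![(p i + s i) * F 0, p i * F 1 + g i * F 2, q i * F 1 + s i * F 2, √2 * v i * F 0,
    -(p i + s i) * F 4 + √2 * v i * F 3 + y i * F 1 + u i * F 2,
    -y i * F 0 - v i * F 2 - p i * F 5 - q i * F 6,
    -u i * F 0 + v i * F 1 - g i * F 5 - s i * F 6] j

theorem sum_struc (p q g s v y u F : Fin 7 → ℝ) (i j : Fin 7) :
    ∑ m, struc p q g s v y u i j m * F m
      = act p q g s v y u F i j - act p q g s v y u F j i := by
  have key : ∀ i j, ∑ m, h3 !![p i, q i; g i, s i] (v i) ![y i, u i] m j * F m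
      = act p q g s v y u F i j := by
    intro i j
    rw [Fin.sum_univ_seven]
    fin_cases j <;> simp [h3, hmat, act] <;> ring
  simp only [struc, sub_mul, Finset.sum_sub_distrib, key]

/-- The component equations when the first basis vector of the `𝔤𝔩(2)`-representation is a common
eigenvector of the `A`-parts of `Λ(e_1), …, Λ(e_4)` with eigenvalue `-c` times the trace. -/
structure NormalEqs (c : ℝ) (p q g s v y u : Fin 7 → ℝ) (P Q G S V : Fin 7 → Fin 7 → ℝ) : Prop
    extends CurvEqs p q g s v y u P Q G S V where
  c_eq : c = 1 ∨ c = 2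
  p_eq : ∀ w : Fin 7, w.val < 4 → p w = -c * (p w + s w)
  g_eq : ∀ w : Fin 7, w.val < 4 → g w = 0
  irr_g : ∃ w, g w ≠ 0
  irr_q : ∃ w, q w ≠ 0
  nonflat : P 4 5 + S 4 5 ≠ 0 ∨ P 4 6 + S 4 6 ≠ 0 ∨ V 4 5 ≠ 0 ∨ V 4 6 ≠ 0

variable {c : ℝ} {p q g s v y u : Fin 7 → ℝ} {P Q G S V : Fin 7 → Fin 7 → ℝ}

theorem NormalEqs.g_ne (H : NormalEqs c p q g s v y u P Q G S V) : g 4 ≠ 0 ∨ g 5 ≠ 0 ∨ g 6 ≠ 0 := by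
  obtain ⟨w, hw⟩ := H.irr_g
  have h0 := H.g_eq 0 (by decide)
  have h1 := H.g_eq 1 (by decide)
  have h2 := H.g_eq 2 (by decide)
  have h3 := H.g_eq 3 (by decide)
  fin_cases w <;> simp_all

theorem NormalEqs.trace_zero (H : NormalEqs c p q g s v y u P Q G S V) : p 0 + s 0 = 0 := by
  have hc := H.c_eq
  have g0 := H.g_eq 0 (by decide)
  have g1 := H.g_eq 1 (by decide)
  have g2 := H.g_eq 2 (by decide)
  have g3 := H.g_eq 3 (by decide)
  have p0 := H.p_eq 0 (by decide)
  have p1 := H.p_eq 1 (by decide)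
  have p2 := H.p_eq 2 (by decide)
  have p3 := H.p_eq 3 (by decide)
  have g456 := H.g_ne
  have f01 := H.flat 0 1 (by decide) (by decide) (by decide) (by decide)
  have f02 := H.flat 0 2 (by decide) (by decide) (by decide) (by decide)
  have f04 := H.flat 0 4 (by decide) (by decide) (by decide) (by decide)
  have f05 := H.flatnull 0 5 (by decide) (by decide)
  have f06 := H.flatnull 0 6 (by decide) (by decide)
  simp only [H.eP, H.eQ, H.eG, H.eS, sum_struc, act, Matrix.cons_val] at f01 f02 f04 f05 f06
  clear H
  by_contra ht
  have t1 : p 1 + s 1 = 0 := by rcases hc with rfl | rfl <;> grind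
  have t2 : p 2 + s 2 = 0 := by rcases hc with rfl | rfl <;> grind
  have q1 : q 1 = 0 := by rcases hc with rfl | rfl <;> grind
  have q2 : q 2 = 0 := by rcases hc with rfl | rfl <;> grind
  have g6 : g 6 = 0 := by rcases hc with rfl | rfl <;> grind
  have g5 : g 5 = 0 := by rcases hc with rfl | rfl <;> grind
  have g4 : g 4 = 0 := by rcases hc with rfl | rfl <;> grind
  grind

end

section

variable {c : ℝ} {p q g s v y u : Fin 7 → ℝ} {P Q G S V : Fin 7 → Fin 7 → ℝ}

set_option maxHeartbeats 1000000 in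
theorem NormalEqs.q_zero (H : NormalEqs c p q g s v y u P Q G S V) : q 0 = 0 := by
  have ht := H.trace_zero
  have hc := H.c_eq
  have g0 := H.g_eq 0 (by decide)
  have g1 := H.g_eq 1 (by decide)
  have g2 := H.g_eq 2 (by decide)
  have g3 := H.g_eq 3 (by decide)
  have p0 := H.p_eq 0 (by decide)
  have p1 := H.p_eq 1 (by decide)
  have p2 := H.p_eq 2 (by decide)
  have p3 := H.p_eq 3 (by decide)
  have g456 := H.g_ne
  have nf := H.nonflat
  have sq : √2 ≠ 0 := by positivity
  have f01 := H.flat 0 1 (by decide) (by decide) (by decide) (by decide)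
  have f02 := H.flat 0 2 (by decide) (by decide) (by decide) (by decide)
  have f12 := H.flat 1 2 (by decide) (by decide) (by decide) (by decide)
  have f03 := H.flat 0 3 (by decide) (by decide) (by decide) (by decide)
  have f04 := H.flat 0 4 (by decide) (by decide) (by decide) (by decide)
  have f05 := H.flatnull 0 5 (by decide) (by decide)
  have f06 := H.flatnull 0 6 (by decide) (by decide)
  have v02 := H.vanV 0 2 (by decide) (by decide)
  have v05 := H.vanV 0 5 (by decide) (by decide)
  have v56 := H.vanV 5 6 (by decide) (by decide)
  have v26 := H.vanV 2 6 (by decide) (by decide)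
  have f56 := H.flat56
  have s4 := H.sym 4 (by decide) (by decide)
  simp only [H.eP, H.eQ, H.eG, H.eS, H.eV, sum_struc, act, Matrix.cons_val] at f01 f02 f12 f03 f04 f05 f06 v02 v05 v56 v26 f56 s4 nf
  clear H
  by_contra hq
  have hp0 : p 0 = 0 := by rw [p0, ht, mul_zero]
  have hs0 : s 0 = 0 := by linarith
  have cp : 0 < c := by rcases hc with rfl | rfl <;> norm_num
  simp only [g0, g1, g2, g3, hp0, hs0, mul_zero, zero_mul, sub_zero, zero_sub, add_zero, zero_add,
    neg_zero] at f01 f02 f12 f03 f04 f05 f06 v02 v05 v26 f56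
  have hs1 : s 1 = 0 := by
    apply mul_left_cancel₀ hq; linarith [f01.2.1]
  have hp1 : p 1 = 0 := by
    rw [hs1] at p1; rcases hc with rfl | rfl <;> linarith
  simp only [hp1, hs1, mul_zero, zero_mul, sub_zero, zero_sub, add_zero, zero_add,
    neg_zero] at f02 f12 f04 f06
  have hq1 : q 1 = 2 * s 2 := by
    apply mul_left_cancel₀ hq; linarith [f02.2.1]
  have hs2 : s 2 = 0 := by
    have := f12.2.1
    rw [hq1] at this
    exact mul_self_eq_zero.1 (by linarith)
  have hp2 : p 2 = 0 := by
    rw [hs2] at p2; rcases hc with rfl | rfl <;> linarith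
  simp only [hp2, hs2, hq1, mul_zero, zero_mul, sub_zero, zero_sub, add_zero, zero_add,
    neg_zero] at f04 f05 f06 v02 v05 v26 s4 nf v56 f56
  have hv0 : √2 * v 0 = 2 * s 3 := by
    apply mul_left_cancel₀ hq; linarith [f03.2.1]
  simp only [hv0] at f04
  have hs3 : s 3 * (p 3 + s 3) = 0 := by linarith [f04.1, f04.2.2.2]
  have hs3 : s 3 = 0 := by
    rcases mul_eq_zero.1 hs3 with h | h
    · exact h
    · rw [h] at p3; linarith
  have hp3 : p 3 = 0 := by
    rw [hs3] at p3; rcases hc with rfl | rfl <;> linarith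
  have hv0 : v 0 = 0 := by
    rw [hs3, mul_zero] at hv0; exact (mul_eq_zero.1 hv0).resolve_left sq
  have g4 : g 4 = 0 := by
    rw [hs3] at f04
    exact (mul_eq_zero.1 (by linarith [f04.1])).resolve_left hq
  simp only [hv0, hs3, hp3, g4, mul_zero, zero_mul, sub_zero, zero_sub, add_zero, zero_add,
    neg_zero] at f05 f06 v02 v05 v26 s4 nf v56 f56
  clear f01 f02 f12 f03 f04
  have g6 : g 6 = 0 := by grind
  have hp6 : p 6 = - g 5 ∧ s 6 = g 5 := by grind
  have g5 : g 5 ≠ 0 := by grind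
  have hv : v 1 = 0 ∧ v 6 = 0 := by grind
  have hv5 : v 5 = 0 := by grind
  have hv2 : v 2 = 0 := by grind
  simp only [hv.1, hv.2, hv5, hv2, g6, hp6.1, hp6.2, mul_zero, zero_mul, sub_zero, zero_sub,
    add_zero, zero_add, neg_zero, hq1, hs2, hp2, hp1, hs1, hs0, hp0] at f56 s4 nf
  have t5 : p 5 + s 5 = 0 := by grind
  have s4' : s 4 = 0 := by grind
  grind

end

section

variable {c : ℝ} {p q g s v y u : Fin 7 → ℝ} {P Q G S V : Fin 7 → Fin 7 → ℝ}

set_option maxHeartbeats 1000000 in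
theorem NormalEqs.trace_one_zero (H : NormalEqs c p q g s v y u P Q G S V) (p0 : p 0 = 0)
    (q0 : q 0 = 0) (s0 : s 0 = 0) (ht2 : p 2 + s 2 = 0) : p 1 + s 1 = 0 := by
  have hc := H.c_eq
  have g0 := H.g_eq 0 (by decide)
  have g1 := H.g_eq 1 (by decide)
  have g2 := H.g_eq 2 (by decide)
  have g3 := H.g_eq 3 (by decide)
  have p1 := H.p_eq 1 (by decide)
  have p2 := H.p_eq 2 (by decide)
  have p3 := H.p_eq 3 (by decide)
  have g456 := H.g_ne
  have sq : √2 ≠ 0 := by positivity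
  have f12 := H.flat 1 2 (by decide) (by decide) (by decide) (by decide)
  have f13 := H.flat 1 3 (by decide) (by decide) (by decide) (by decide)
  have f23 := H.flat 2 3 (by decide) (by decide) (by decide) (by decide)
  have f14 := H.flat 1 4 (by decide) (by decide) (by decide) (by decide)
  have f24 := H.flat 2 4 (by decide) (by decide) (by decide) (by decide)
  have f05 := H.flatnull 0 5 (by decide) (by decide)
  have f06 := H.flatnull 0 6 (by decide) (by decide)
  have f56 := H.flat56
  have y1 := H.sym 1 (by decide) (by decide)
  have y2 := H.sym 2 (by decide) (by decide)
  have y12 := H.sym12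
  have t15 := H.vanT 1 5 (by decide) (by decide)
  have t16 := H.vanT 1 6 (by decide) (by decide)
  have t25 := H.vanT 2 5 (by decide) (by decide)
  have t26 := H.vanT 2 6 (by decide) (by decide)
  simp only [H.eP, H.eQ, H.eG, H.eS, sum_struc, act, Matrix.cons_val, g0, g1, g2, g3,
    p0, q0, s0, mul_zero, zero_mul, sub_zero, zero_sub, add_zero, zero_add,
    neg_zero]
    at f12 f13 f23 f14 f24 f05 f06 f56 y1 y2 y12 t15 t16 t25 t26
  have irr := H.irr_q
  clear H
  by_contra ht
  have hp2 : p 2 = 0 := by rw [p2, ht2, mul_zero]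
  have hs2 : s 2 = 0 := by linarith
  have hp1 : p 1 ≠ 0 := by
    intro h; rw [h] at p1 ht; rcases hc with rfl | rfl <;> exact ht (by linarith)
  have hs1 : (1 + c) * p 1 = - c * s 1 := by linarith
  have hs1' : s 1 ≠ 0 := by
    intro h; rw [h] at hs1; rcases hc with rfl | rfl <;> exact hp1 (by linarith)
  simp only [hp2, hs2, mul_zero, zero_mul, sub_zero, zero_sub, add_zero, zero_add,
    neg_zero] at f12 f13 f23 f14 f24 f05 f06 f56 y1 y2 y12 t15 t16 t25 t26
  have hq1 : q 1 = 0 := by grind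
  have hq2 : q 2 = 0 := by rcases hc with rfl | rfl <;> grind
  have hv0 : v 0 = 0 := by grind
  simp only [hq1, hq2, hv0, mul_zero, zero_mul, sub_zero, zero_sub, add_zero, zero_add,
    neg_zero] at f12 f13 f23 f14 f24 f05 f06 f56 y1 y2 y12 t15 t16 t25 t26
  have hp3 : p 3 = 0 := by grind
  have hs3 : s 3 = 0 := by rcases hc with rfl | rfl <;> grind
  have hq3 : q 3 = 0 := by rcases hc with rfl | rfl <;> grind
  simp only [hp3, hs3, hq3, mul_zero, zero_mul, sub_zero, zero_sub, add_zero, zero_add,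
    neg_zero] at f12 f13 f23 f14 f24 f05 f06 f56 y1 y2 y12 t15 t16 t25 t26
  have hq4 : q 4 = 0 := by rcases hc with rfl | rfl <;> grind
  have hq5 : q 5 = 0 := by grind
  have hq6 : q 6 = v 2 := by grind
  have hq6 : q 6 = 0 := by grind
  obtain ⟨w, hw⟩ := irr
  fin_cases w
  exacts [hw q0, hw hq1, hw hq2, hw hq3, hw hq4, hw hq5, hw hq6]

end

section

variable {c : ℝ} {p q g s v y u : Fin 7 → ℝ} {P Q G S V : Fin 7 → Fin 7 → ℝ}

set_option maxHeartbeats 1000000 in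
theorem NormalEqs.A_two_zero (H : NormalEqs c p q g s v y u P Q G S V) (p0 : p 0 = 0)
    (q0 : q 0 = 0) (s0 : s 0 = 0) (ht1 : p 1 + s 1 = 0) : q 1 = 0 ∧ q 2 = 0 ∧ p 2 + s 2 = 0 := by
  have hc := H.c_eq
  have g0 := H.g_eq 0 (by decide)
  have g1 := H.g_eq 1 (by decide)
  have g2 := H.g_eq 2 (by decide)
  have g3 := H.g_eq 3 (by decide)
  have p1 := H.p_eq 1 (by decide)
  have p2 := H.p_eq 2 (by decide)
  have p3 := H.p_eq 3 (by decide)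
  have g456 := H.g_ne
  have sq : √2 ≠ 0 := by positivity
  have f12 := H.flat 1 2 (by decide) (by decide) (by decide) (by decide)
  have f13 := H.flat 1 3 (by decide) (by decide) (by decide) (by decide)
  have f23 := H.flat 2 3 (by decide) (by decide) (by decide) (by decide)
  have f14 := H.flat 1 4 (by decide) (by decide) (by decide) (by decide)
  have f24 := H.flat 2 4 (by decide) (by decide) (by decide) (by decide)
  have f05 := H.flatnull 0 5 (by decide) (by decide)
  have f06 := H.flatnull 0 6 (by decide) (by decide)
  have f56 := H.flat56
  have y1 := H.sym 1 (by decide) (by decide)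
  have y2 := H.sym 2 (by decide) (by decide)
  have y12 := H.sym12
  have t15 := H.vanT 1 5 (by decide) (by decide)
  have t16 := H.vanT 1 6 (by decide) (by decide)
  have t25 := H.vanT 2 5 (by decide) (by decide)
  have t26 := H.vanT 2 6 (by decide) (by decide)
  simp only [H.eP, H.eQ, H.eG, H.eS, sum_struc, act, Matrix.cons_val, g0, g1, g2, g3,
    p0, q0, s0, mul_zero, zero_mul, sub_zero, zero_sub, add_zero, zero_add,
    neg_zero]
    at f12 f13 f23 f14 f24 f05 f06 f56 y1 y2 y12 t15 t16 t25 t26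
  clear H
  have hp1 : p 1 = 0 := by rw [p1, ht1, mul_zero]
  have hs1 : s 1 = 0 := by linarith
  have hs2 : (1 + c) * p 2 = - c * s 2 := by linarith
  simp only [hp1, hs1, mul_zero, zero_mul, sub_zero, zero_sub, add_zero, zero_add,
    neg_zero] at f12 f13 f23 f14 f24 f05 f06 f56 y1 y2 y12 t15 t16 t25 t26
  have h1 : q 1 = 0 ∨ q 1 = s 2 := by grind
  have hne : q 1 = 0 := by
    by_contra hq
    have hs : q 1 = s 2 := by grind
    have hv0 : v 0 = 0 := by grind
    simp only [hv0, hs, mul_zero, zero_mul, sub_zero, zero_sub, add_zero, zero_add,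
    neg_zero] at f12 f13 f23 f14 f24 f05 f06 f56 y1 y2 y12 t15 t16 t25 t26
    have hs2' : s 2 ≠ 0 := hs ▸ hq
    have hp2' : p 2 ≠ 0 := by
      intro h; rw [h] at hs2; rcases hc with rfl | rfl <;> exact hs2' (by linarith)
    have hg4 : g 4 = 0 := by grind
    have hg6 : g 6 = 0 := by
      have : g 6 * p 2 = 0 := by linarith [y1.1]
      exact (mul_eq_zero.1 this).resolve_right hp2'
    simp only [hg6, mul_zero, zero_mul, sub_zero, zero_sub, add_zero, zero_add,
      neg_zero] at y1 y2 y12 t26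
    have hg5 : s 2 * g 5 = 0 := by linarith [y12.2.1, y1.2, y2.1, t26, y12.2.2.1]
    have hg5 : g 5 = 0 := (mul_eq_zero.1 hg5).resolve_left hs2'
    exact g456.elim (· hg4) fun h => h.elim (· hg5) (· hg6)
  simp only [hne, mul_zero, zero_mul, sub_zero, zero_sub, add_zero, zero_add,
    neg_zero] at f12 f13 f23 f14 f24 f05 f06 f56 y1 y2 y12 t15 t16 t25 t26
  refine ⟨hne, ?_⟩
  by_contra hq
  have hv0 : v 0 = 0 := by grind
  simp only [hv0, mul_zero, zero_mul, sub_zero, zero_sub, add_zero, zero_add,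
    neg_zero] at f12 f13 f23 f14 f24 f05 f06 f56 y1 y2 y12 t15 t16 t25 t26
  have hg6 : g 6 = 0 := by
    by_contra h
    have hp2 : p 2 = 0 := (mul_eq_zero.1 (by linarith [y1.1] : g 6 * p 2 = 0)).resolve_left h
    have hs2 : s 2 = 0 := (mul_eq_zero.1 (by linarith [y1.1, t16] : g 6 * s 2 = 0)).resolve_left h
    rw [hs2] at y1
    have : q 2 = 0 := (mul_eq_zero.1 (by linarith [y1.2] : g 6 * q 2 = 0)).resolve_left h
    exact hq ⟨this, by rw [hp2, hs2, add_zero]⟩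
  simp only [hg6, mul_zero, zero_mul, sub_zero, zero_sub, add_zero, zero_add,
    neg_zero] at f56 y1 y2 y12 t26
  by_cases hs2' : s 2 = 0
  · have hp2' : p 2 = 0 := by
      rw [hs2'] at hs2; rcases hc with rfl | rfl <;> linarith
    have hq2 : q 2 ≠ 0 := fun h => hq ⟨h, by rw [hp2', hs2', add_zero]⟩
    simp only [hs2', hp2', mul_zero, zero_mul, sub_zero, zero_sub, add_zero, zero_add,
      neg_zero] at f23 f24 f56 y1 y2 y12 t25
    have h0 : 2 * s 3 - p 3 = 0 :=
      (mul_eq_zero.1 (by linarith [f23.2.1] : q 2 * (2 * s 3 - p 3) = 0)).resolve_left hq2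
    have hp3 : p 3 = 0 := by rcases hc with rfl | rfl <;> linarith
    rw [hp3, mul_zero, sub_zero] at f24
    have hg4 : g 4 = 0 := (mul_eq_zero.1 f24.1).resolve_left hq2
    have h1 : p 6 + s 6 = 0 :=
      (mul_eq_zero.1 (by linarith [t25] : q 2 * (p 6 + s 6) = 0)).resolve_left hq2
    have h2 : g 5 - p 6 + s 6 = 0 :=
      (mul_eq_zero.1 (by linarith [y2.2] : q 2 * (g 5 - p 6 + s 6) = 0)).resolve_left hq2
    have hp6 : p 6 = - s 6 := by linarith
    have hg5' : g 5 = -2 * s 6 := by linarith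
    have h3 := f56.2.2.1
    rw [hg5', hp6] at h3
    have hs6 : s 6 = 0 := pow_eq_zero_iff two_ne_zero |>.1 (by linarith : s 6 ^ 2 = 0)
    have hg5 : g 5 = 0 := by rw [hg5', hs6, mul_zero]
    exact g456.elim (· hg4) fun h => h.elim (· hg5) (· hg6)
  · have hg4 : g 4 = 0 :=
      (mul_eq_zero.1 (by linarith [f24.2.2.1] : s 2 * g 4 = 0)).resolve_left hs2'
    have hg5 : g 5 = 0 :=
      (mul_eq_zero.1 (by linarith [y12.2.1, y1.2] : s 2 * g 5 = 0)).resolve_left hs2'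
    exact g456.elim (· hg4) fun h => h.elim (· hg5) (· hg6)

theorem NormalEqs.vanish (H : NormalEqs c p q g s v y u P Q G S V)
    (h : p 1 + s 1 = 0 ∨ p 2 + s 2 = 0) (w : Fin 7) (hw : w.val < 3) :
    p w = 0 ∧ q w = 0 ∧ g w = 0 ∧ s w = 0 := by
  have of_trace : ∀ w : Fin 7, w.val < 4 → p w + s w = 0 → p w = 0 ∧ s w = 0 := by
    intro w hw ht
    have hp := H.p_eq w hw
    rw [ht, mul_zero] at hp
    exact ⟨hp, by linarith⟩
  obtain ⟨p0, s0⟩ := of_trace 0 (by decide) H.trace_zero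
  have h1 : p 1 + s 1 = 0 := h.elim id (H.trace_one_zero p0 H.q_zero s0)
  obtain ⟨q1, q2, h2⟩ := H.A_two_zero p0 H.q_zero s0 h1
  obtain ⟨p1, s1⟩ := of_trace 1 (by decide) h1
  obtain ⟨p2, s2⟩ := of_trace 2 (by decide) h2
  have hw' : w = 0 ∨ w = 1 ∨ w = 2 := by revert w; decide
  rcases hw' with rfl | rfl | rfl
  · exact ⟨p0, H.q_zero, H.g_eq 0 (by decide), s0⟩
  · exact ⟨p1, q1, H.g_eq 1 (by decide), s1⟩
  · exact ⟨p2, q2, H.g_eq 2 (by decide), s2⟩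

end

section

/-- The action of `(a, b; c, d) ∈ SL(2,ℝ)` on `ℝ^7`. -/
def sl2Lift (a b c d : ℝ) : M7 :=
  !![1, 0, 0, 0, 0, 0, 0;
     0, a, b, 0, 0, 0, 0;
     0, c, d, 0, 0, 0, 0;
     0, 0, 0, 1, 0, 0, 0;
     0, 0, 0, 0, 1, 0, 0;
     0, 0, 0, 0, 0, d, -c;
     0, 0, 0, 0, 0, -b, a]

theorem sl2Lift_mul_inv {a b c d : ℝ} (h : a * d - b * c = 1) :
    sl2Lift a b c d * sl2Lift d (-b) (-c) a = 1 := by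
  ext i j
  rw [Matrix.mul_apply, Fin.sum_univ_seven]
  fin_cases i <;> fin_cases j <;> simp [sl2Lift, Matrix.one_apply] <;> linarith

set_option maxHeartbeats 2000000 in
theorem sl2Lift_conj {a b c d : ℝ} (h : a * d - b * c = 1) (p q g s v y u : ℝ) :
    sl2Lift d (-b) (-c) a * h3 !![p, q; g, s] v ![y, u] * sl2Lift a b c d =
      h3 !![d * (p * a + q * c) - b * (g * a + s * c), d * (p * b + q * d) - b * (g * b + s * d);
        a * (g * a + s * c) - c * (p * a + q * c), a * (g * b + s * d) - c * (p * b + q * d)]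
        v ![d * y - b * u, a * u - c * y] := by
  have hd : a * d = 1 + b * c := by linarith
  ext i j
  rw [Matrix.mul_assoc]
  fin_cases i <;> fin_cases j <;>
    simp [sl2Lift, h3, hmat, Matrix.mul_apply, Fin.sum_univ_seven] <;> first | ring1 | grind

/-- The conjugate of `L` by an element of `SL(2,ℝ)`. -/
def conjL (a b c d : ℝ) (L : V7 →ₗ[ℝ] M7) : V7 →ₗ[ℝ] M7 where
  toFun x := sl2Lift d (-b) (-c) a * L (sl2Lift a b c d *ᵥ x) * sl2Lift a b c d
  map_add' x y := by simp only [Matrix.mulVec_add, map_add, mul_add, add_mul]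
  map_smul' r x := by
    simp only [Matrix.mulVec_smul, map_smul, mul_smul_comm, smul_mul_assoc, RingHom.id_apply]

variable {a b c d : ℝ} {L : V7 →ₗ[ℝ] M7}

theorem conjL_apply (x : V7) : conjL a b c d L x =
    sl2Lift d (-b) (-c) a * L (sl2Lift a b c d *ᵥ x) * sl2Lift a b c d := rfl

theorem lieBr_conjL (x y : V7) : lieBr (conjL a b c d L) x y =
    sl2Lift d (-b) (-c) a *ᵥ lieBr L (sl2Lift a b c d *ᵥ x) (sl2Lift a b c d *ᵥ y) := by
  simp only [lieBr, conjL_apply, Matrix.mulVec_sub, Matrix.mulVec_mulVec, Matrix.mul_assoc]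

theorem curv_conjL (h : a * d - b * c = 1) (x y : V7) :
    curv (conjL a b c d L) (lieBr (conjL a b c d L)) x y = sl2Lift d (-b) (-c) a *
      curv L (lieBr L) (sl2Lift a b c d *ᵥ x) (sl2Lift a b c d *ᵥ y) * sl2Lift a b c d := by
  have key : ∀ X Y : M7, sl2Lift d (-b) (-c) a * X * sl2Lift a b c d *
      (sl2Lift d (-b) (-c) a * Y * sl2Lift a b c d)
      = sl2Lift d (-b) (-c) a * (X * Y) * sl2Lift a b c d := by
    intro X Y
    calc _ = sl2Lift d (-b) (-c) a * X * (sl2Lift a b c d * sl2Lift d (-b) (-c) a) * Y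
          * sl2Lift a b c d := by simp only [Matrix.mul_assoc]
      _ = _ := by rw [sl2Lift_mul_inv h]; simp only [Matrix.mul_assoc, Matrix.mul_one]
  simp only [curv, lieBr_conjL, conjL_apply, Matrix.mulVec_mulVec, sl2Lift_mul_inv h,
    Matrix.one_mulVec, key, Matrix.mul_sub, Matrix.sub_mul]

theorem jacobi_conjL (h : a * d - b * c = 1) (hL : Jacobi L) : Jacobi (conjL a b c d L) := by
  intro x y z
  simp only [lieBr_conjL, Matrix.mulVec_mulVec, sl2Lift_mul_inv h, Matrix.one_mulVec,
    ← Matrix.mulVec_add]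
  rw [hL, Matrix.mulVec_zero]

/-- The `A`-part of `X ∈ 𝔥^III` moves the direction of `f`. -/
def Moves (X : M7) (f₀ f₁ : ℝ) : Prop :=
  f₀ * (X 2 1 * f₀ + X 2 2 * f₁) - f₁ * (X 1 1 * f₀ + X 1 2 * f₁) ≠ 0

/-- A connection with values in `𝔥^III` whose `A`-part is irreducible and whose curvature is not
contained in the ideal `{tr A = 0, v = 0}`. -/
structure IrredSetup (L : V7 →ₗ[ℝ] M7) : Prop where
  mem : ∀ x, L x ∈ hIII
  jac : Jacobi L
  irr : ∀ f₀ f₁ : ℝ, f₀ ≠ 0 ∨ f₁ ≠ 0 → ∃ x, Moves (L x) f₀ f₁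
  nv : ∃ x y, curv L (lieBr L) x y 1 1 + curv L (lieBr L) x y 2 2 ≠ 0 ∨
    curv L (lieBr L) x y 1 6 ≠ 0

theorem conj_entries (h : a * d - b * c = 1) {X : M7} (hX : X ∈ hIII) :
    sl2Lift d (-b) (-c) a * X * sl2Lift a b c d ∈ hIII ∧
    (sl2Lift d (-b) (-c) a * X * sl2Lift a b c d) 1 1
      = d * (X 1 1 * a + X 1 2 * c) - b * (X 2 1 * a + X 2 2 * c) ∧
    (sl2Lift d (-b) (-c) a * X * sl2Lift a b c d) 1 2
      = d * (X 1 1 * b + X 1 2 * d) - b * (X 2 1 * b + X 2 2 * d) ∧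
    (sl2Lift d (-b) (-c) a * X * sl2Lift a b c d) 2 1
      = a * (X 2 1 * a + X 2 2 * c) - c * (X 1 1 * a + X 1 2 * c) ∧
    (sl2Lift d (-b) (-c) a * X * sl2Lift a b c d) 2 2
      = a * (X 2 1 * b + X 2 2 * d) - c * (X 1 1 * b + X 1 2 * d) ∧
    (sl2Lift d (-b) (-c) a * X * sl2Lift a b c d) 1 6 = X 1 6 := by
  have := sl2Lift_conj h (X 1 1) (X 1 2) (X 2 1) (X 2 2) (X 1 6) (X 1 4) (X 2 4)
  rw [← eq_h3_of_mem hX] at this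
  rw [this]
  refine ⟨⟨_, _, _, rfl⟩, ?_⟩
  simp [h3, hmat]

theorem IrredSetup.conj (H : IrredSetup L) (h : a * d - b * c = 1) :
    IrredSetup (conjL a b c d L) where
  mem x := (conj_entries h (H.mem _)).1
  jac := jacobi_conjL h H.jac
  irr f₀ f₁ hf := by
    obtain ⟨x, hx⟩ := H.irr (a * f₀ + b * f₁) (c * f₀ + d * f₁) (by
      by_contra! hc
      have h0 : f₀ = 0 := by linear_combination (-f₀) * h + d * hc.1 - b * hc.2
      have h1 : f₁ = 0 := by linear_combination (-f₁) * h + a * hc.2 - c * hc.1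
      rcases hf with hf | hf
      exacts [hf h0, hf h1])
    refine ⟨sl2Lift d (-b) (-c) a *ᵥ x, ?_⟩
    rw [conjL_apply, Matrix.mulVec_mulVec, sl2Lift_mul_inv h, Matrix.one_mulVec]
    obtain ⟨-, e11, e12, e21, e22, -⟩ := conj_entries h (H.mem x)
    rw [Moves, e11, e12, e21, e22]
    rw [Moves] at hx
    convert hx using 1
    ring
  nv := by
    obtain ⟨x, y, hxy⟩ := H.nv
    refine ⟨sl2Lift d (-b) (-c) a *ᵥ x, sl2Lift d (-b) (-c) a *ᵥ y, ?_⟩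
    rw [curv_conjL h]
    simp only [Matrix.mulVec_mulVec, sl2Lift_mul_inv h, Matrix.one_mulVec]
    obtain ⟨-, e11, e12, e21, e22, e16⟩ := conj_entries h (curv_mem_hIII H.mem x y)
    rw [e16]
    refine hxy.imp_left fun hne => ?_
    convert hne using 1
    rw [e11, e22]
    linear_combination (curv L (lieBr L) x y 1 1 + curv L (lieBr L) x y 2 2) * h

theorem map_eq_sum (L : V7 →ₗ[ℝ] M7) (x : V7) : L x = ∑ m, x m • L (e m) := by
  conv_lhs => rw [show x = ∑ m, x m • e m by ext m; simp [e, Finset.sum_apply, Pi.single_apply]]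
  rw [map_sum]
  simp only [map_smul]

end

section

variable {L : V7 →ₗ[ℝ] M7}

theorem curv_eq_sum (L : V7 →ₗ[ℝ] M7) (x y : V7) :
    curv L (lieBr L) x y = ∑ i, ∑ j, (x i * y j) • cv L i j := by
  have key : ∀ x y, curv L (lieBr L) x y = ∑ i, x i • curv L (lieBr L) (e i) y := by
    intro x y
    have hx : x = ∑ m, x m • e m := by ext m; simp [e, Finset.sum_apply, Pi.single_apply]
    conv_lhs => rw [hx]
    exact (map_sum (curvLeft L y) _ _).trans (by simp only [map_smul]; rfl)
  rw [key]
  refine Finset.sum_congr rfl fun i _ => ?_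
  rw [curv_antisymm, key, ← Finset.sum_neg_distrib, Finset.smul_sum]
  refine Finset.sum_congr rfl fun j _ => ?_
  rw [curv_antisymm, smul_neg, smul_neg, smul_neg, neg_neg, smul_smul, cv]

theorem CurvEqs.trace_form_zero {p q g s v y u : Fin 7 → ℝ} {P Q G S V : Fin 7 → Fin 7 → ℝ}
    (H : CurvEqs p q g s v y u P Q G S V) (hn : P 4 5 + S 4 5 = 0 ∧ P 4 6 + S 4 6 = 0)
    (i j : Fin 7) : P i j + S i j = 0 := by
  have h4 : ∀ j, P 4 j + S 4 j = 0 := by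
    intro j
    by_cases h5 : j = 5
    · rw [h5]; exact hn.1
    by_cases h6 : j = 6
    · rw [h6]; exact hn.2
    obtain ⟨hP, -, -, hS⟩ := H.flat 4 j (by decide) (by decide) h5 h6
    rw [hP, hS, add_zero]
  by_cases hi : i = 4
  · rw [hi]; exact h4 j
  by_cases hj : j = 4
  · rw [hj, H.antiP, H.antiS]; linarith [h4 i]
  exact H.vanT i j hi hj

theorem CurvEqs.v_form_zero {p q g s v y u : Fin 7 → ℝ} {P Q G S V : Fin 7 → Fin 7 → ℝ}
    (H : CurvEqs p q g s v y u P Q G S V) (hn : V 4 5 = 0 ∧ V 4 6 = 0)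
    (i j : Fin 7) : V i j = 0 := by
  have h4 : ∀ j, V 4 j = 0 := by
    intro j
    by_cases h4 : j = 4
    · rw [h4]; linarith [H.antiV 4 4]
    by_cases h5 : j = 5
    · rw [h5]; exact hn.1
    by_cases h6 : j = 6
    · rw [h6]; exact hn.2
    rw [H.antiV, H.vanV4 j h4 h5 h6, neg_zero]
  by_cases hi : i = 4
  · rw [hi]; exact h4 j
  by_cases hj : j = 4
  · rw [hj, H.antiV, h4, neg_zero]
  exact H.vanV i j hi hj

theorem IrredSetup.nonflat (H : IrredSetup L) : cv L 4 5 1 1 + cv L 4 5 2 2 ≠ 0 ∨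
    cv L 4 6 1 1 + cv L 4 6 2 2 ≠ 0 ∨ cv L 4 5 1 6 ≠ 0 ∨ cv L 4 6 1 6 ≠ 0 := by
  have hE := curvEqs H.mem H.jac
  by_contra! hn
  obtain ⟨x, y, hxy⟩ := H.nv
  rw [curv_eq_sum] at hxy
  simp only [Matrix.sum_apply, Matrix.smul_apply, smul_eq_mul, ← Finset.sum_add_distrib,
    ← mul_add, hE.trace_form_zero ⟨hn.1, hn.2.1⟩, hE.v_form_zero hn.2.2, mul_zero,
    Finset.sum_const_zero, ne_eq, not_true, or_false] at hxy

/-- If `f` is a common eigenvector for `Λ(e_1), …, Λ(e_4)` with eigenvalue `-c` times the trace,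
the `A`-parts of `Λ(e_1), Λ(e_2), Λ(e_3)` vanish. -/
theorem IrredSetup.vanish_of_eigen (H : IrredSetup L) {c f₀ f₁ : ℝ} (hc : c = 1 ∨ c = 2)
    (hf : f₀ ≠ 0 ∨ f₁ ≠ 0)
    (heig : ∀ w : Fin 7, w.val < 4 →
      L (e w) 1 1 * f₀ + L (e w) 1 2 * f₁ = -c * (L (e w) 1 1 + L (e w) 2 2) * f₀ ∧
      L (e w) 2 1 * f₀ + L (e w) 2 2 * f₁ = -c * (L (e w) 1 1 + L (e w) 2 2) * f₁)
    (w : Fin 7) (hw : w.val < 3) :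
    L (e w) 1 1 = 0 ∧ L (e w) 1 2 = 0 ∧ L (e w) 2 1 = 0 ∧ L (e w) 2 2 = 0 := by
  obtain ⟨b, d, h, ht⟩ : ∃ b d : ℝ, f₀ * d - b * f₁ = 1 ∧
      ((f₀ * (L (e 1) 1 1 + L (e 1) 2 2) + f₁ * (L (e 2) 1 1 + L (e 2) 2 2) = 0) ∨
      (b * (L (e 1) 1 1 + L (e 1) 2 2) + d * (L (e 2) 1 1 + L (e 2) 2 2) = 0)) := by
    generalize L (e 1) 1 1 + L (e 1) 2 2 = t₁
    generalize L (e 2) 1 1 + L (e 2) 2 2 = t₂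
    by_cases ht : f₀ * t₁ + f₁ * t₂ = 0
    · have hn : f₀ ^ 2 + f₁ ^ 2 ≠ 0 := by
        rcases hf with hf | hf <;> positivity
      refine ⟨-f₁ / (f₀ ^ 2 + f₁ ^ 2), f₀ / (f₀ ^ 2 + f₁ ^ 2), ?_, Or.inl ht⟩
      field_simp
      ring
    · refine ⟨-t₂ / (f₀ * t₁ + f₁ * t₂), t₁ / (f₀ * t₁ + f₁ * t₂), ?_, Or.inr ?_⟩
      · field_simp
        ring
      · ring
  have ent : ∀ w, _ := fun w => (conj_entries h (H.mem (sl2Lift f₀ b f₁ d *ᵥ e w))).2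
  simp only [← conjL_apply] at ent
  have lin : ∀ w i j, L (sl2Lift f₀ b f₁ d *ᵥ e w) i j
      = ∑ m, sl2Lift f₀ b f₁ d m w * L (e m) i j := by
    intro w i j
    rw [map_eq_sum, Matrix.sum_apply]
    simp [e]
  have heig' : ∀ w : Fin 7, w.val < 4 →
      conjL f₀ b f₁ d L (e w) 1 1
        = -c * (conjL f₀ b f₁ d L (e w) 1 1 + conjL f₀ b f₁ d L (e w) 2 2) ∧
      conjL f₀ b f₁ d L (e w) 2 1 = 0 := by
    intro w hw
    obtain ⟨e11, -, e21, e22, -⟩ := ent w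
    have hX : L (sl2Lift f₀ b f₁ d *ᵥ e w) 1 1 * f₀ + L (sl2Lift f₀ b f₁ d *ᵥ e w) 1 2 * f₁
        = -c * (L (sl2Lift f₀ b f₁ d *ᵥ e w) 1 1 + L (sl2Lift f₀ b f₁ d *ᵥ e w) 2 2) * f₀ ∧
      L (sl2Lift f₀ b f₁ d *ᵥ e w) 2 1 * f₀ + L (sl2Lift f₀ b f₁ d *ᵥ e w) 2 2 * f₁
        = -c * (L (sl2Lift f₀ b f₁ d *ᵥ e w) 1 1 + L (sl2Lift f₀ b f₁ d *ᵥ e w) 2 2) * f₁ := by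
      have h0 := heig 0 (by decide)
      have h1 := heig 1 (by decide)
      have h2 := heig 2 (by decide)
      have h3 := heig 3 (by decide)
      simp only [lin, Fin.sum_univ_seven]
      rcases eq_of_lt_four hw with rfl | rfl | rfl | rfl
      · simpa [sl2Lift] using h0
      · simp [sl2Lift]
        exact ⟨by linear_combination f₀ * h1.1 + f₁ * h2.1,
          by linear_combination f₀ * h1.2 + f₁ * h2.2⟩
      · simp [sl2Lift]
        exact ⟨by linear_combination b * h1.1 + d * h2.1,
          by linear_combination b * h1.2 + d * h2.2⟩
      · simpa [sl2Lift] using h3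
    generalize L (sl2Lift f₀ b f₁ d *ᵥ e w) = X at e11 e21 e22 hX
    rw [e11, e21, e22]
    constructor
    · linear_combination d * hX.1 - b * hX.2
    · linear_combination f₀ * hX.2 - f₁ * hX.1
  have H' := H.conj h
  have hE := curvEqs H'.mem H'.jac
  have hN := NormalEqs.mk hE hc (fun w hw => (heig' w hw).1) (fun w hw => (heig' w hw).2)
    (by
      by_contra! hg
      obtain ⟨x, hx⟩ := H'.irr 1 0 (Or.inl one_ne_zero)
      apply hx
      rw [map_eq_sum]
      simp [Matrix.sum_apply, hg])
    (by
      by_contra! hq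
      obtain ⟨x, hx⟩ := H'.irr 0 1 (Or.inr one_ne_zero)
      apply hx
      rw [map_eq_sum]
      simp [Matrix.sum_apply, hq])
    H'.nonflat
  have hv := hN.vanish (by
    have tr : ∀ w, conjL f₀ b f₁ d L (e w) 1 1 + conjL f₀ b f₁ d L (e w) 2 2 =
        L (sl2Lift f₀ b f₁ d *ᵥ e w) 1 1 + L (sl2Lift f₀ b f₁ d *ᵥ e w) 2 2 := by
      intro w
      obtain ⟨e11, -, -, e22, -⟩ := ent w
      rw [e11, e22]
      linear_combination (L (sl2Lift f₀ b f₁ d *ᵥ e w) 1 1 + L (sl2Lift f₀ b f₁ d *ᵥ e w) 2 2) * h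
    rw [tr, tr]
    simp only [lin, Fin.sum_univ_seven]
    refine ht.imp (fun ht => ?_) (fun ht => ?_)
    · simp [sl2Lift]; linarith
    · simp [sl2Lift]; linarith)
  have hv' : ∀ w : Fin 7, w.val < 3 → ∀ i j : Fin 7, (i = 1 ∨ i = 2) → (j = 1 ∨ j = 2) →
      L (sl2Lift f₀ b f₁ d *ᵥ e w) i j = 0 := by
    intro w hw
    obtain ⟨z1, z2, z3, z4⟩ := hv w hw
    obtain ⟨e11, e12, e21, e22, -⟩ := ent w
    rw [z1] at e11
    rw [z2] at e12
    rw [z3] at e21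
    rw [z4] at e22
    generalize L (sl2Lift f₀ b f₁ d *ᵥ e w) = X at e11 e12 e21 e22
    rintro i j (rfl | rfl) (rfl | rfl)
    · linear_combination (-X 1 1) * (f₀ * d - b * f₁ + 1) * h
        - f₀ * d * e11 + f₀ * f₁ * e12 - b * d * e21 + b * f₁ * e22
    · linear_combination (-X 1 2) * (f₀ * d - b * f₁ + 1) * h
        + f₀ * b * e11 - f₀ * f₀ * e12 + b * b * e21 - b * f₀ * e22
    · linear_combination (-X 2 1) * (f₀ * d - b * f₁ + 1) * h
        - f₁ * d * e11 + f₁ * f₁ * e12 - d * d * e21 + d * f₁ * e22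
    · linear_combination (-X 2 2) * (f₀ * d - b * f₁ + 1) * h
        + f₁ * b * e11 - f₁ * f₀ * e12 + d * b * e21 - d * f₀ * e22
  have fin : ∀ i j : Fin 7, (i = 1 ∨ i = 2) → (j = 1 ∨ j = 2) → L (e w) i j = 0 := by
    intro i j hi hj
    have z0 := hv' 0 (by decide) i j hi hj
    have z1 := hv' 1 (by decide) i j hi hj
    have z2 := hv' 2 (by decide) i j hi hj
    simp only [lin, Fin.sum_univ_seven] at z0 z1 z2
    simp [sl2Lift] at z0 z1 z2
    have hw' : w = 0 ∨ w = 1 ∨ w = 2 := by revert w; decide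
    rcases hw' with rfl | rfl | rfl
    · exact z0
    · linear_combination d * z1 - f₁ * z2 - L (e 1) i j * h
    · linear_combination f₀ * z2 - b * z1 - L (e 2) i j * h
  simp [fin]

/-- In the irreducible case the `A`-parts of `Λ(e_1), Λ(e_2), Λ(e_3)` vanish. -/
theorem IrredSetup.vanish (H : IrredSetup L) (w : Fin 7) (hw : w.val < 3) :
    L (e w) 1 1 = 0 ∧ L (e w) 1 2 = 0 ∧ L (e w) 2 1 = 0 ∧ L (e w) 2 2 = 0 := by
  have hE := curvEqs H.mem H.jac
  by_cases hT : cv L 4 5 1 1 + cv L 4 5 2 2 = 0 ∧ cv L 4 6 1 1 + cv L 4 6 2 2 = 0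
  · refine H.vanish_of_eigen (c := 2) (f₀ := cv L 4 5 1 6) (f₁ := cv L 4 6 1 6) (Or.inr rfl)
      ((H.nonflat.resolve_left (not_not.2 hT.1)).resolve_left (not_not.2 hT.2)) ?_ w hw
    intro w hw
    have h := hE.sigma_form w hw
    simp only [hT, mul_zero] at h
    exact ⟨by linarith [h.1], by linarith [h.2]⟩
  · refine H.vanish_of_eigen (c := 1) (f₀ := cv L 4 5 1 1 + cv L 4 5 2 2)
      (f₁ := cv L 4 6 1 1 + cv L 4 6 2 2) (Or.inl rfl) (by tauto) ?_ w hw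
    intro w hw
    have h := hE.ricci_form w hw
    exact ⟨by linarith [h.1], by linarith [h.2]⟩

end

section

variable {L : V7 →ₗ[ℝ] M7}

theorem curv_mem_infHol (L : V7 →ₗ[ℝ] M7) (bk : V7 → V7 → V7) (x y : V7) :
    curv L bk x y ∈ infHol L bk :=
  Submodule.mem_sInf.2 fun _ hH => hH.1 x y

theorem comm_mem_infHol {bk : V7 → V7 → V7} {X : M7} (hX : X ∈ infHol L bk)
    (z : V7) : L z * X - X * L z ∈ infHol L bk :=
  Submodule.mem_sInf.2 fun H hH => hH.2 z X (Submodule.mem_sInf.1 hX H hH)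

/-- A set of matrices in `𝔥^III` cut out by a linear condition that contains the curvature and
is stable under bracketing contains the infinitesimal holonomy. -/
theorem infHol_induction {bk : V7 → V7 → V7} (hmem : ∀ x, L x ∈ hIII)
    (hbk : bk = lieBr L) {E : Type*} [AddCommGroup E] [Module ℝ E] (φ : M7 →ₗ[ℝ] E)
    (hcurv : ∀ x y, φ (curv L bk x y) = 0)
    (hcomm : ∀ z, ∀ X ∈ hIII, φ X = 0 → φ (L z * X - X * L z) = 0) {X : M7}
    (hX : X ∈ infHol L bk) : φ X = 0 := by
  subst hbk
  have : infHol L (lieBr L) ≤ hIIIsub ⊓ LinearMap.ker φ :=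
    sInf_le ⟨fun x y => ⟨curv_mem_hIII hmem x y, hcurv x y⟩,
      fun z X hX => ⟨comm_mem_hIII (hmem z) hX.1, hcomm z X hX.1 hX.2⟩⟩
  exact (this hX).2

/-- The entry functional of matrices. -/
def entryL (i j : Fin 7) : M7 →ₗ[ℝ] ℝ := Matrix.entryLinearMap ℝ ℝ i j

theorem entryL_apply (i j : Fin 7) (X : M7) : entryL i j X = X i j := rfl

theorem comm_entries {X Y : M7} (hX : X ∈ hIII) (hY : Y ∈ hIII) :
    (X * Y - Y * X) 1 1 = X 1 2 * Y 2 1 - Y 1 2 * X 2 1 ∧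
    (X * Y - Y * X) 1 2 = X 1 1 * Y 1 2 + X 1 2 * Y 2 2 - Y 1 1 * X 1 2 - Y 1 2 * X 2 2 ∧
    (X * Y - Y * X) 2 1 = X 2 1 * Y 1 1 + X 2 2 * Y 2 1 - Y 2 1 * X 1 1 - Y 2 2 * X 2 1 ∧
    (X * Y - Y * X) 2 2 = X 2 1 * Y 1 2 - Y 2 1 * X 1 2 ∧
    (X * Y - Y * X) 1 6 = (X 1 1 + X 2 2) * Y 1 6 - (Y 1 1 + Y 2 2) * X 1 6 := by
  rw [eq_h3_of_mem hX, eq_h3_of_mem hY, h3_comm]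
  simp [h3, hmat, Matrix.trace, Fin.sum_univ_two]
  refine ⟨?_, ?_, ?_, ?_⟩ <;> ring

theorem not_moves_comm {X Y : M7} (hX : X ∈ hIII) (hY : Y ∈ hIII) {f₀ f₁ : ℝ}
    (hf : f₀ ≠ 0 ∨ f₁ ≠ 0) (h₁ : ¬ Moves X f₀ f₁) (h₂ : ¬ Moves Y f₀ f₁) :
    ¬ Moves (X * Y - Y * X) f₀ f₁ := by
  obtain ⟨e11, e12, e21, e22, -⟩ := comm_entries hX hY
  rw [Moves, not_not] at *
  rw [e11, e12, e21, e22]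
  rcases hf with hf | hf
  · refine (mul_eq_zero.1 ?_).resolve_left hf
    linear_combination (Y 1 1 * f₀ + Y 1 2 * f₁ - f₀ * Y 2 2 + f₁ * Y 1 2) * h₁
      - (X 1 1 * f₀ + X 1 2 * f₁ - f₀ * X 2 2 + f₁ * X 1 2) * h₂
  · refine (mul_eq_zero.1 ?_).resolve_left hf
    linear_combination (Y 2 1 * f₀ + Y 2 2 * f₁ + f₀ * Y 2 1 - f₁ * Y 1 1) * h₁
      - (X 2 1 * f₀ + X 2 2 * f₁ + f₀ * X 2 1 - f₁ * X 1 1) * h₂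

/-- The functional `det(f, A f)` of the `A`-part. -/
def movesL (f₀ f₁ : ℝ) : M7 →ₗ[ℝ] ℝ :=
  f₀ • (f₀ • entryL 2 1 + f₁ • entryL 2 2) - f₁ • (f₀ • entryL 1 1 + f₁ • entryL 1 2)

theorem movesL_eq_zero {f₀ f₁ : ℝ} {X : M7} : movesL f₀ f₁ X = 0 ↔ ¬ Moves X f₀ f₁ := by
  simp [movesL, Moves, entryL_apply, mul_comm, mul_add]

theorem irredSetup_of_mem_infHol (hmem : ∀ x, L x ∈ hIII) (hjac : Jacobi L)
    (hrot : h3 !![0, -1; 1, 0] 0 0 ∈ infHol L (lieBr L)) (hv : h3 0 1 0 ∈ infHol L (lieBr L)) :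
    IrredSetup L where
  mem := hmem
  jac := hjac
  irr f₀ f₁ hf := by
    by_contra! hA
    have key := infHol_induction hmem rfl (movesL f₀ f₁) ?_ ?_ hrot
    · simp [movesL, entryL_apply, h3, hmat] at key
      have : f₀ * f₀ + f₁ * f₁ = 0 := by linarith
      rcases hf with hf | hf <;> apply hf <;> nlinarith
    · intro x y
      rw [curv, map_sub, movesL_eq_zero.2 (hA _),
        movesL_eq_zero.2 (not_moves_comm (hmem x) (hmem y) hf (hA x) (hA y)), sub_zero]
    · intro z X hX h
      rw [movesL_eq_zero] at h ⊢
      exact not_moves_comm (hmem z) hX hf (hA z) h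
  nv := by
    by_contra! h
    have key := infHol_induction hmem rfl ((entryL 1 1 + entryL 2 2).prod (entryL 1 6)) ?_ ?_ hv
    · simp [entryL_apply, h3, hmat] at key
    · intro x y
      simp [entryL_apply, h]
    · intro z X hX h
      obtain ⟨e11, -, -, e22, e16⟩ := comm_entries (hmem z) hX
      simp only [LinearMap.prod_apply, Function.prod_apply, LinearMap.add_apply, entryL_apply,
        Prod.mk_eq_zero] at h ⊢
      rw [e11, e22, e16, h.1, h.2]
      constructor <;> ring

end

section

variable {L : V7 →ₗ[ℝ] M7}

theorem Xg2_mem_hIII {s : Fin 14 → ℝ} (h4 : s 4 = 0) (h6 : s 6 = 0) (h7 : s 7 = 0) (h8 : s 8 = 0)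
    (h9 : s 9 = 0) (h12 : s 12 = 0) (h13 : s 13 = 0) : Xg2 s ∈ hIII := by
  refine ⟨!![s 0, s 1; s 2, s 3], s 5, ![s 10, s 11], ?_⟩
  ext i j
  fin_cases i <;> fin_cases j <;> simp [Xg2, h3, hmat, h4, h6, h7, h8, h9, h12, h13] <;> ring

/-- The entries of a matrix in `𝔥^III` that vanish, together with its skew part. -/
theorem hIII_entries {X : M7} (h : X ∈ hIII) : X 0 1 = 0 ∧ X 0 2 = 0 ∧ X 1 0 = 0 ∧ X 2 0 = 0 ∧
    X 3 0 = 0 ∧ X 4 1 = 0 ∧ X 4 2 = 0 ∧ X 1 3 = 0 ∧ X 4 4 = -(X 1 1 + X 2 2) ∧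
    X 0 6 = - X 2 4 := by
  obtain ⟨A, v, y, rfl⟩ := h
  simp [h3, hmat]

theorem sq_two_mul : √2 * √2 = 2 := Real.mul_self_sqrt zero_le_two

theorem comm_diag_entry (s : Fin 14 → ℝ) (a d : ℝ) {i j : Fin 7} :
    (Xg2 s * h3 !![a, 0; 0, d] 0 0 - h3 !![a, 0; 0, d] 0 0 * Xg2 s) i j =
      Xg2 s i j * (![a + d, a, d, 0, -(a + d), -a, -d] j - ![a + d, a, d, 0, -(a + d), -a, -d] i) := by
  have : h3 !![a, 0; 0, d] 0 0 = Matrix.diagonal ![a + d, a, d, 0, -(a + d), -a, -d] := by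
    ext i j
    fin_cases i <;> fin_cases j <;> simp [h3, hmat, Matrix.diagonal]
  rw [this, Matrix.sub_apply, Matrix.mul_diagonal, Matrix.diagonal_mul]
  ring

theorem mul_eq_zero_of_comm_diag {s : Fin 14 → ℝ} {a d : ℝ}
    (h : Xg2 s * h3 !![a, 0; 0, d] 0 0 - h3 !![a, 0; 0, d] 0 0 * Xg2 s ∈ hIII) :
    s 6 * a = 0 ∧ s 7 * d = 0 ∧ s 8 * a = 0 ∧ s 9 * d = 0 ∧ s 4 * (a + d) = 0 ∧
      s 12 * (2 * a + d) = 0 ∧ s 13 * (a + 2 * d) = 0 := by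
  obtain ⟨h01, h02, h10, h20, h30, h41, h42, -, -⟩ := hIII_entries h
  rw [comm_diag_entry] at h01 h02 h10 h20 h30 h41 h42
  have sq : √2 ≠ 0 := by positivity
  simp only [Xg2, Matrix.cons_val, Matrix.of_apply] at h01 h02 h10 h20 h30 h41 h42
  refine ⟨by linarith, by linarith, by linarith, by linarith, ?_, by linarith, by linarith⟩
  exact (mul_eq_zero.1 (by linarith : √2 * (s 4 * (a + d)) = 0)).resolve_left sq

theorem comm_v_entries (s : Fin 14 → ℝ) :
    (Xg2 s * h3 0 1 0 - h3 0 1 0 * Xg2 s) 4 4 = 2 * s 4 ∧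
    (Xg2 s * h3 0 1 0 - h3 0 1 0 * Xg2 s) 1 3 = - 2 * √2 * s 7 ∧
    (Xg2 s * h3 0 1 0 - h3 0 1 0 * Xg2 s) 0 6 = - 3 * s 9 := by
  simp [Xg2, h3, hmat, Matrix.mul_apply, Fin.sum_univ_seven]
  have := sq_two_mul
  refine ⟨?_, ?_, ?_⟩ <;> grind

theorem mem_semidir_two {a : Set M2} {A : M2} (hA : A ∈ a) (v : ℝ) (y : Fin 2 → ℝ) :
    h3 A v y ∈ semidir a 2 :=
  ⟨A, hA, v, y, rfl⟩

theorem part_of_mem_semidir {a : Set M2} {k : ℕ} {X : M7} (h : X ∈ semidir a k) :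
    X ∈ hIII ∧ !![X 1 1, X 1 2; X 2 1, X 2 2] ∈ a := by
  unfold semidir at h
  split at h
  · obtain ⟨A, hA, v, y, rfl⟩ := h
    exact ⟨⟨_, _, _, rfl⟩, by convert hA; ext i j; fin_cases i <;> fin_cases j <;> simp [h3, hmat]⟩
  · obtain ⟨A, hA, v, y, rfl⟩ := h
    exact ⟨⟨_, _, _, rfl⟩, by convert hA; ext i j; fin_cases i <;> fin_cases j <;> simp [h3, hmat]⟩

/-- `Λ` takes values in `𝔥^III` if the holonomy contains suitable diagonal matrices. -/
theorem mem_hIII_of_normalizes {a : Set M2} {s : Fin 14 → ℝ}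
    (ha : a = sl2 ∨ a = gl2 ∨ a = co2 ∨ a = dd)
    (h : ∀ X ∈ semidir a 2, Xg2 s * X - X * Xg2 s ∈ semidir a 2) :
    Xg2 s ∈ hIII ∧ (a = dd → s 1 = 0 ∧ s 2 = 0) := by
  have hd : ∀ t r : ℝ, !![t, 0; 0, r] ∈ a → _ := fun t r htr =>
    mul_eq_zero_of_comm_diag (part_of_mem_semidir (h _ (mem_semidir_two htr 0 0))).1
  rcases ha with rfl | rfl | rfl | rfl
  · obtain ⟨h6, h7, h8, h9, -, h12, h13⟩ := hd 1 (-1) (by simp [sl2])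
    obtain ⟨hm, ht⟩ := part_of_mem_semidir (h _ (mem_semidir_two (A := 0) (by simp [sl2]) 1 0))
    have h4 := (comm_v_entries s).1
    rw [(hIII_entries hm).2.2.2.2.2.2.2.2.1] at h4
    simp only [sl2, Set.mem_ofPred_eq, Matrix.of_apply, Matrix.cons_val] at ht
    exact ⟨Xg2_mem_hIII (by linarith) (by linarith) (by linarith) (by linarith) (by linarith)
      (by linarith) (by linarith), fun h => by
      have : !![1, 0; 0, 1] ∈ sl2 := h ▸ (by simp [dd])
      norm_num [sl2] at this⟩
  · obtain ⟨h6, h7, h8, h9, h4, h12, h13⟩ := hd 1 1 trivial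
    exact ⟨Xg2_mem_hIII (by linarith) (by linarith) (by linarith) (by linarith) (by linarith)
      (by linarith) (by linarith), fun h => by
      have : !![1, 1; 0, 1] ∈ dd := h ▸ trivial
      norm_num [dd] at this⟩
  · obtain ⟨h6, h7, h8, h9, h4, h12, h13⟩ := hd 1 1 ⟨1, 0, by simp⟩
    exact ⟨Xg2_mem_hIII (by linarith) (by linarith) (by linarith) (by linarith) (by linarith)
      (by linarith) (by linarith), fun h => by
      have : !![0, -1; 1, 0] ∈ dd := h ▸ ⟨0, 1, rfl⟩
      norm_num [dd] at this⟩
  · obtain ⟨h6, -, h8, -, h4, h12, h13⟩ := hd 1 0 (by simp [dd])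
    obtain ⟨-, h7, -, h9, -, -, -⟩ := hd 0 1 (by simp [dd])
    have hm := (part_of_mem_semidir (h (h3 !![1, 0; 0, 0] 0 0)
      (mem_semidir_two (by simp [dd]) 0 0))).2
    simp only [dd, Set.mem_ofPred_eq, Matrix.of_apply, Matrix.cons_val, comm_diag_entry] at hm
    simp [Xg2] at hm
    exact ⟨Xg2_mem_hIII (by linarith) (by linarith) (by linarith) (by linarith) (by linarith)
      (by linarith) (by linarith), fun _ => by tauto⟩

end

section

variable {L : V7 →ₗ[ℝ] M7}

theorem CurvEqs.diagonal {p q g s v y u : Fin 7 → ℝ} {P Q G S V : Fin 7 → Fin 7 → ℝ}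
    (H : CurvEqs p q g s v y u P Q G S V) (hq : ∀ i, q i = 0) (hg : ∀ i, g i = 0) :
    (P 4 5 = 0 → ∀ i j, P i j = 0) ∧ (S 4 6 = 0 → ∀ i j, S i j = 0) ∧ P 4 6 = 0 ∧ S 4 5 = 0 := by
  have hQ : ∀ i j, Q i j = 0 := fun i j => by rw [H.eQ]; simp [hq]
  have hG : ∀ i j, G i j = 0 := fun i j => by rw [H.eG]; simp [hg]
  have sym : ∀ i, i ≠ 5 → i ≠ 6 → P i 6 = 0 ∧ S i 5 = 0 := fun i h5 h6 => by
    have := H.sym i h5 h6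
    rwa [hG, hQ] at this
  have sym12 := H.sym12
  simp only [hQ, hG] at sym12
  have t15 := H.vanT 1 5 (by decide) (by decide)
  have t26 := H.vanT 2 6 (by decide) (by decide)
  have t25 := H.vanT 2 5 (by decide) (by decide)
  have t16 := H.vanT 1 6 (by decide) (by decide)
  have P5 : P 4 5 = 0 → ∀ i, i ≠ 5 → i ≠ 6 → P i 5 = 0 := by
    intro h i h5 h6
    have f0 := (H.flatnull 0 5 (by decide) (by decide)).1
    have f3 := (H.flatnull 3 5 (by decide) (by decide)).1
    have f1 : P 1 5 = 0 := by linarith [sym12.2.1]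
    have f2 := sym12.1
    fin_cases i
    exacts [f0, f1, f2, f3, h, absurd rfl h5, absurd rfl h6]
  have S6 : S 4 6 = 0 → ∀ i, i ≠ 5 → i ≠ 6 → S i 6 = 0 := by
    intro h i h5 h6
    have f0 := (H.flatnull 0 6 (by decide) (by decide)).2.2.2
    have f3 := (H.flatnull 3 6 (by decide) (by decide)).2.2.2
    have f1 := sym12.2.2.2
    have f2 : S 2 6 = 0 := by linarith [sym12.2.2.1]
    fin_cases i
    exacts [f0, f1.symm, f2, f3, h, absurd rfl h5, absurd rfl h6]
  have ext_zero : ∀ F : Fin 7 → Fin 7 → ℝ, (∀ i j, F i j = - F j i) → F 5 6 = 0 →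
      (∀ i j, i ≠ 5 → i ≠ 6 → j ≠ 5 → j ≠ 6 → F i j = 0) →
      (∀ i, i ≠ 5 → i ≠ 6 → F i 5 = 0) → (∀ i, i ≠ 5 → i ≠ 6 → F i 6 = 0) →
      ∀ i j, F i j = 0 := by
    intro F ha h56 h0 h5 h6
    have d : ∀ i, F i i = 0 := fun i => by linarith [ha i i]
    have c5 : ∀ i, F i 5 = 0 := by
      intro i
      by_cases i5 : i = 5
      · rw [i5, d]
      by_cases i6 : i = 6
      · rw [i6, ha, h56, neg_zero]
      exact h5 i i5 i6
    have c6 : ∀ i, F i 6 = 0 := by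
      intro i
      by_cases i5 : i = 5
      · rw [i5, h56]
      by_cases i6 : i = 6
      · rw [i6, d]
      exact h6 i i5 i6
    intro i j
    by_cases i5 : i = 5
    · rw [i5, ha, c5, neg_zero]
    by_cases i6 : i = 6
    · rw [i6, ha, c6, neg_zero]
    by_cases j5 : j = 5
    · rw [j5, c5]
    by_cases j6 : j = 6
    · rw [j6, c6]
    exact h0 i j i5 i6 j5 j6
  exact ⟨fun h => ext_zero P H.antiP H.flat56.1 (fun i j a b c d => (H.flat i j a b c d).1)
      (P5 h) (fun i a b => (sym i a b).1),
    fun h => ext_zero S H.antiS H.flat56.2.2.2 (fun i j a b c d => (H.flat i j a b c d).2.2.2)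
      (fun i a b => (sym i a b).2) (S6 h),
    (sym 4 (by decide) (by decide)).1, (sym 4 (by decide) (by decide)).2⟩

/-- In the diagonal case the `A`-parts of `Λ(e_1), …, Λ(e_4)` vanish. -/
theorem vanish_of_diagonal (hmem : ∀ x, L x ∈ hIII) (hjac : Jacobi L)
    (hq : ∀ x, L x 1 2 = 0) (hg : ∀ x, L x 2 1 = 0)
    (h1 : h3 !![1, 0; 0, 0] 0 0 ∈ infHol L (lieBr L))
    (h2 : h3 !![0, 0; 0, 1] 0 0 ∈ infHol L (lieBr L)) (w : Fin 7) (hw : w.val < 4) :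
    L (e w) 1 1 = 0 ∧ L (e w) 2 2 = 0 := by
  have H := curvEqs hmem hjac
  obtain ⟨hP, hS, P46, S45⟩ := H.diagonal (fun i => hq _) (fun i => hg _)
  have P45 : cv L 4 5 1 1 ≠ 0 := by
    intro h
    have key := infHol_induction hmem rfl (entryL 1 1) ?_ ?_ h1
    · simp [entryL_apply, h3, hmat] at key
    · intro x y
      rw [curv_eq_sum, entryL_apply]
      simp [Matrix.sum_apply, hP h]
    · intro z X hX _
      rw [entryL_apply, (comm_entries (hmem z) hX).1, hq, hg]
      ring
  have S46 : cv L 4 6 2 2 ≠ 0 := by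
    intro h
    have key := infHol_induction hmem rfl (entryL 2 2) ?_ ?_ h2
    · simp [entryL_apply, h3, hmat] at key
    · intro x y
      rw [curv_eq_sum, entryL_apply]
      simp [Matrix.sum_apply, hS h]
    · intro z X hX _
      rw [entryL_apply, (comm_entries (hmem z) hX).2.2.2.1, hq, hg]
      ring
  have h := H.ricci_form w hw
  simp only [hq, hg, S45, P46, zero_mul, zero_add, add_zero, mul_eq_zero, P45, S46, or_false] at h
  exact ⟨by linarith [h.1, h.2], by linarith [h.1, h.2]⟩

/-- If the `A`-part of `Λ(e_i)` vanishes for `i ≤ 3` then `e_1, e_2, e_3` commute. -/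
theorem lieBr_eq_zero (hmem : ∀ x, L x ∈ hIII)
    (h : ∀ w : Fin 7, w.val < 3 →
      L (e w) 1 1 = 0 ∧ L (e w) 1 2 = 0 ∧ L (e w) 2 1 = 0 ∧ L (e w) 2 2 = 0)
    (i j : Fin 7) (hi : i.val < 3) (hj : j.val < 3) : lieBr L (e i) (e j) = 0 := by
  have key : ∀ i j : Fin 7, i.val < 3 → j.val < 3 → L (e i) *ᵥ e j = 0 := by
    intro i j hi hj
    obtain ⟨h1, h2, h3', h4⟩ := h i hi
    rw [eq_h3_of_mem (hmem (e i)), h1, h2, h3', h4]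
    have hj' : j = 0 ∨ j = 1 ∨ j = 2 := by revert j; decide
    rcases hj' with rfl | rfl | rfl <;> ext m <;> fin_cases m <;> simp [e, h3, hmat]
  rw [lieBr, key i j hi hj, key j i hj hi, sub_zero]

end

/-- The matrices that normalize `ℝ·diag(1,0) ⋉ 𝔪(1,0,k)` in `𝔤₂*`. -/
def dmat (α β w v y u : ℝ) : M7 := hmat !![α, 0; 0, β] v ![0, w] ![y, u]

theorem Xg2_eq_dmat_of_normalizes {k : ℕ} (hk : k = 1 ∨ k = 2) {s : Fin 14 → ℝ}
    (h : ∀ X ∈ semidir rdiag10 k, Xg2 s * X - X * Xg2 s ∈ semidir rdiag10 k) :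
    Xg2 s = dmat (s 0) (s 3) (s 9) (s 5) (s 10) (s 11) := by
  have mem : ∀ t v : ℝ, h3 !![t, 0; 0, 0] v 0 ∈ semidir rdiag10 k := by
    intro t v
    rcases hk with rfl | rfl
    · exact ⟨_, ⟨t, rfl⟩, v, 0, by congr 1; ext i; fin_cases i <;> rfl⟩
    · exact ⟨_, ⟨t, rfl⟩, v, 0, rfl⟩
  obtain ⟨hm, t, ht⟩ := part_of_mem_semidir (h _ (mem 1 0))
  obtain ⟨h6, -, h8, -, h4, h12, h13⟩ := mul_eq_zero_of_comm_diag hm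
  have z : (!![0, 0; 0, 0] : M2) = 0 := by ext i j; fin_cases i <;> fin_cases j <;> rfl
  have hv := (hIII_entries (part_of_mem_semidir (h _ (mem 0 1))).1).2.2.2.2.2.2.2.1
  rw [z, (comm_v_entries s).2.1] at hv
  have q := congrFun (congrFun ht 0) 1
  have g := congrFun (congrFun ht 1) 0
  simp only [Matrix.of_apply, Matrix.cons_val, comm_diag_entry] at q g
  simp [Xg2] at q g
  have h7 : s 7 = 0 := by simpa using hv
  simp only [mul_one, add_zero, mul_zero, mul_eq_zero] at h6 h8 h4 h12 h13
  have h12' : s 12 = 0 := by linarith [h12.resolve_right (by norm_num)]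
  ext i j
  fin_cases i <;> fin_cases j <;>
    simp [Xg2, dmat, hmat, h6, h8, h4, h12', h13, q, g, h7] <;> ring

/-- The structure constants determined by the components of `Λ`. -/
def dstr (α β w v y u : Fin 7 → ℝ) (i j m : Fin 7) : ℝ :=
  dmat (α i) (β i) (w i) (v i) (y i) (u i) m j - dmat (α j) (β j) (w j) (v j) (y j) (u j) m i

/-- The component equations of a torsion-free connection with values in the normalizer of
`ℝ·diag(1,0) ⋉ 𝔪(1,0,k)` and with curvature in that algebra. -/
structure DiagEqs (α β w v y u : Fin 7 → ℝ) (P V Y U : Fin 7 → Fin 7 → ℝ) : Prop where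
  antiP : ∀ i j, P i j = - P j i
  eP : ∀ i j, P i j = - ∑ m, dstr α β w v y u i j m * α m
  eB : ∀ i j, ∑ m, dstr α β w v y u i j m * β m = 0
  eW : ∀ i j, w j * β i - w i * β j = ∑ m, dstr α β w v y u i j m * w m
  eV : ∀ i j, V i j = α i * v j - v i * β j - α j * v i + v j * β i
    - ∑ m, dstr α β w v y u i j m * v m
  eY : ∀ i j, Y i j = α i * y j - y i * (α j + β j) - α j * y i + y j * (α i + β i)
    - ∑ m, dstr α β w v y u i j m * y m
  eU : ∀ i j, U i j = β i * u j + 2 * w i * v j - v i * w j - u i * (α j + β j)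
    - (β j * u i + 2 * w j * v i - v j * w i - u j * (α i + β i))
    - ∑ m, dstr α β w v y u i j m * u m
  vanP : ∀ i j, P 4 5 = 0 → P i j = 0
  vanP' : ∀ i j, i ≠ 4 → j ≠ 4 → P i j = 0
  vanP4 : ∀ i, i ≠ 5 → P 4 i = 0
  vanV : ∀ i j, i ≠ 4 → j ≠ 4 → V i j = 0
  special : Y 0 4 = P 4 5 ∧ Y 1 5 = P 4 5 ∧ Y 0 5 = 0 ∧ U 0 5 = 0 ∧ Y 0 6 = 0 ∧ U 0 6 = 0 ∧
    Y 1 4 = 0 ∧ U 0 4 = 0 ∧ U 1 4 = 0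
  flat3 : ∀ i, i = 0 ∨ i = 1 ∨ i = 2 → Y i 3 = 0 ∧ U i 3 = 0
  second : ∀ i j k, (∑ m, dstr α β w v y u i j m * P m k)
    + (∑ m, dstr α β w v y u j k m * P m i)
    + (∑ m, dstr α β w v y u k i m * P m j) = 0

theorem dmat_comm_entries (α β w v y u α' β' w' v' y' u' : ℝ) :
    let C := dmat α β w v y u * dmat α' β' w' v' y' u' - dmat α' β' w' v' y' u' * dmat α β w v y u
    C 1 1 = 0 ∧ C 2 2 = 0 ∧ C 5 4 = w' * β - w * β' ∧
    C 1 6 = α * v' - v * β' - α' * v + v' * β ∧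
    C 1 4 = α * y' - y * (α' + β') - α' * y + y' * (α + β) ∧
    C 2 4 = β * u' + 2 * w * v' - v * w' - u * (α' + β')
      - (β' * u + 2 * w' * v - v' * w - u' * (α + β)) := by
  have := sq_two_mul
  simp [dmat, hmat, Matrix.mul_apply, Fin.sum_univ_seven]
  refine ⟨?_, ?_, ?_, ?_, ?_, ?_⟩ <;> grind

section

variable {L : V7 →ₗ[ℝ] M7}

theorem bianchi_diag {P V Y U : Fin 7 → Fin 7 → ℝ} {R : Fin 7 → Fin 7 → M7}
    (hR : ∀ i j, R i j = h3 !![P i j, 0; 0, 0] (V i j) ![Y i j, U i j])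
    (anti : ∀ i j, R i j = - R j i)
    (b : ∀ i j k m, R i j m k + R j k m i + R k i m j = 0) :
    (∀ i j, P i j = - P j i) ∧
    (∀ i j, P 4 5 = 0 → P i j = 0) ∧ (∀ i j, i ≠ 4 → j ≠ 4 → P i j = 0) ∧
    (∀ i, i ≠ 5 → P 4 i = 0) ∧ (∀ i j, i ≠ 4 → j ≠ 4 → V i j = 0) ∧
    (Y 0 4 = P 4 5 ∧ Y 1 5 = P 4 5 ∧ Y 0 5 = 0 ∧ U 0 5 = 0 ∧ Y 0 6 = 0 ∧ U 0 6 = 0 ∧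
      Y 1 4 = 0 ∧ U 0 4 = 0 ∧ U 1 4 = 0) ∧
    ∀ i, i = 0 ∨ i = 1 ∨ i = 2 → Y i 3 = 0 ∧ U i 3 = 0 := by
  have B := bianchi_linear P (fun _ _ => 0) (fun _ _ => 0) (fun _ _ => 0) V Y U R hR anti b
  have aY : ∀ i j, Y i j = - Y j i := fun i j => by
    simpa [hR, h3, hmat] using congrFun (congrFun (anti i j) 1) 4
  have aU : ∀ i j, U i j = - U j i := fun i j => by
    simpa [hR, h3, hmat] using congrFun (congrFun (anti i j) 2) 4
  have e0 : ∀ i j, R i j 0 = ![P i j, 0, 0, √2 * V i j, 0, - Y i j, - U i j] := by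
    intro i j; rw [hR]; ext m; fin_cases m <;> simp [h3, hmat]
  have e1 : ∀ i j, R i j 1 = ![0, P i j, 0, 0, Y i j, 0, V i j] := by
    intro i j; rw [hR]; ext m; fin_cases m <;> simp [h3, hmat]
  have e2 : ∀ i j, R i j 2 = ![0, 0, 0, 0, U i j, -V i j, 0] := by
    intro i j; rw [hR]; ext m; fin_cases m <;> simp [h3, hmat]
  have v' : ∀ i j, i ≠ 4 → j ≠ 4 → P i j = 0 := fun i j hi hj => by simpa using B.vanT i j hi hj
  have p4 : ∀ i, i ≠ 5 → P 4 i = 0 := by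
    intro i hi
    by_cases h6 : i = 6
    · rw [h6]; exact (B.sym 4 (by decide) (by decide)).1
    · exact (B.flat 4 i (by decide) (by decide) hi h6).1
  have vV4 := fun i h4 h5 h6 => (neg_eq_zero (a := V i 4)).2 (B.vanV4 i h4 h5 h6)
  refine ⟨B.antiP, fun i j h => ?_, v', p4, B.vanV, ?_, ?_⟩
  · have h4 : ∀ i, P 4 i = 0 := fun i => by
      by_cases h5 : i = 5
      · rw [h5, h]
      · exact p4 i h5
    by_cases i4 : i = 4
    · rw [i4, h4]
    by_cases j4 : j = 4
    · rw [j4, B.antiP, h4, neg_zero]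
    exact v' i j i4 j4
  · have b1 := b 0 4 5 0
    have b2 := b 1 5 4 1
    have b3 := b 0 5 4 1
    have b4 := b 0 5 4 2
    have b5 := b 0 6 4 1
    have b6 := b 0 6 4 2
    have b7 := b 1 4 5 0
    have b8 := b 0 4 6 0
    have b9 := b 1 4 6 0
    simp only [e0, e1, e2, Matrix.cons_val] at b1 b2 b3 b4 b5 b6 b7 b8 b9
    have q1 := B.antiP 5 4
    have q2 := p4 6 (by decide)
    have q3 := B.vanV4 0 (by decide) (by decide) (by decide)
    have q4 := B.antiV 4 0
    refine ⟨?_, ?_, ?_, ?_, ?_, ?_, ?_, ?_, ?_⟩ <;> linarith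
  · intro i hi
    have b1 := b i 3 4 1
    have b2 := b i 3 4 2
    have q1 := B.antiP 4 3
    have q2 := p4 3 (by decide)
    have q3 : P 3 4 = 0 := by linarith
    rcases hi with rfl | rfl | rfl <;>
    · simp only [e1, e2, Matrix.cons_val] at b1 b2
      constructor <;> linarith

theorem entries_of_mem_semidir {k : ℕ} {X : M7} (h : X ∈ semidir rdiag10 k) :
    X = h3 !![X 1 1, 0; 0, 0] (X 1 6) ![X 1 4, X 2 4] ∧ X 2 2 = 0 ∧ X 5 4 = 0 := by
  obtain ⟨hm, t, ht⟩ := part_of_mem_semidir h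
  have h1 := congrFun (congrFun ht 0) 1
  have h2 := congrFun (congrFun ht 1) 0
  have h3' := congrFun (congrFun ht 1) 1
  simp at h1 h2 h3'
  have := eq_h3_of_mem hm
  rw [h1, h2, h3'] at this
  refine ⟨this, h3', ?_⟩
  obtain ⟨A, v, y, rfl⟩ := hm
  simp [h3, hmat]

theorem diagEqs {k : ℕ} (hjac : Jacobi L)
    (hL : ∀ x, L x = dmat (L x 1 1) (L x 2 2) (L x 5 4) (L x 1 6) (L x 1 4) (L x 2 4))
    (hc : ∀ x y, curv L (lieBr L) x y ∈ semidir rdiag10 k) :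
    DiagEqs (fun z => L (e z) 1 1) (fun z => L (e z) 2 2) (fun z => L (e z) 5 4)
      (fun z => L (e z) 1 6) (fun z => L (e z) 1 4) (fun z => L (e z) 2 4)
      (fun i j => cv L i j 1 1) (fun i j => cv L i j 1 6)
      (fun i j => cv L i j 1 4) (fun i j => cv L i j 2 4) := by
  have hs : ∀ i j m, dstr (fun z => L (e z) 1 1) (fun z => L (e z) 2 2) (fun z => L (e z) 5 4)
      (fun z => L (e z) 1 6) (fun z => L (e z) 1 4) (fun z => L (e z) 2 4)
      i j m = L (e i) m j - L (e j) m i := by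
    intro i j m
    rw [dstr, ← hL, ← hL]
  have hcomm : ∀ a b, _ := fun a b => dmat_comm_entries (L a 1 1) (L a 2 2) (L a 5 4) (L a 1 6)
    (L a 1 4) (L a 2 4) (L b 1 1) (L b 2 2) (L b 5 4) (L b 1 6) (L b 1 4) (L b 2 4)
  simp only [← hL] at hcomm
  have hcv : ∀ i j m k, cv L i j m k = (L (e i) * L (e j) - L (e j) * L (e i)) m k
      - ∑ l, (L (e i) l j - L (e j) l i) * L (e l) m k := by
    intro i j m k
    rw [cv, curv_basis, Matrix.sub_apply, Matrix.sum_apply]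
    simp only [Matrix.smul_apply, smul_eq_mul]
  obtain ⟨antiP, vanP, vanP', vanP4, vanV, special, flat3⟩ :=
    bianchi_diag (fun i j => (entries_of_mem_semidir (hc (e i) (e j))).1)
      (fun i j => curv_antisymm L (e i) (e j)) (fun i j k m => by
        have := congrFun (curv_bianchi L hjac (e i) (e j) (e k)) m
        simpa [e] using this)
  refine ⟨antiP, ?_, ?_, ?_, ?_, ?_, ?_, vanP, vanP', vanP4, vanV, special, flat3, ?_⟩
  · intro i j
    simp only [hs]
    rw [hcv, (hcomm _ _).1, zero_sub]
  · intro i j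
    simp only [hs]
    have h := hcv i j 2 2
    rw [(hcomm _ _).2.1, cv, (entries_of_mem_semidir (hc (e i) (e j))).2.1] at h
    linarith
  · intro i j
    simp only [hs]
    have h := hcv i j 5 4
    rw [(hcomm _ _).2.2.1, cv, (entries_of_mem_semidir (hc (e i) (e j))).2.2] at h
    linarith
  · intro i j
    simp only [hs]
    rw [hcv, (hcomm _ _).2.2.2.1]
  · intro i j
    simp only [hs]
    rw [hcv, (hcomm _ _).2.2.2.2.1]
  · intro i j
    simp only [hs]
    rw [hcv, (hcomm _ _).2.2.2.2.2]
  · intro i j k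
    have key : ∀ a b, curv L (lieBr L) a b 1 1 = - L (lieBr L a b) 1 1 := by
      intro a b
      rw [curv, Matrix.sub_apply, (hcomm _ _).1, zero_sub]
    have h := congrArg (fun w => - L w 1 1) (hjac (e i) (e j) (e k))
    simp only [map_add, Matrix.add_apply, map_zero, Matrix.zero_apply, neg_add, ← key,
      curv_lieBr_basis, Matrix.sum_apply, Matrix.smul_apply, smul_eq_mul, neg_zero] at h
    simp only [hs]
    exact h

end

section

variable {α β w v y u : Fin 7 → ℝ} {P V Y U : Fin 7 → Fin 7 → ℝ}

/-- The functional `F` applied to `Λ(e_i) e_j`. -/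
def dact (α β w v y u F : Fin 7 → ℝ) (i j : Fin 7) : ℝ :=
  ![(α i + β i) * F 0, -w i * F 0 + α i * F 1, β i * F 2, √2 * v i * F 0 + √2 * w i * F 2,
    y i * F 1 + u i * F 2 + √2 * v i * F 3 - (α i + β i) * F 4 + w i * F 5,
    -y i * F 0 - v i * F 2 - α i * F 5, -u i * F 0 + v i * F 1 + √2 * w i * F 3 - β i * F 6] j

theorem sum_dstr (α β w v y u F : Fin 7 → ℝ) (i j : Fin 7) :
    ∑ m, dstr α β w v y u i j m * F m = dact α β w v y u F i j - dact α β w v y u F j i := by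
  have h : ∀ i j, ∑ m, dmat (α i) (β i) (w i) (v i) (y i) (u i) m j * F m
      = dact α β w v y u F i j := by
    intro i j
    simp only [Fin.sum_univ_seven]
    fin_cases j <;> simp [dmat, hmat, dact] <;> ring
  simp only [dstr, sub_mul, Finset.sum_sub_distrib, h]

theorem DiagEqs.trace_form (H : DiagEqs α β w v y u P V Y U) (hp : P 4 5 ≠ 0) (m : Fin 7)
    (h4 : m ≠ 4) (h5 : m ≠ 5) : 2 * α m + β m = 0 := by
  have h := H.second m 4 5
  simp only [sum_dstr, dact] at h
  have P4 := H.vanP4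
  have P5 : ∀ i, i ≠ 4 → P i 5 = 0 := fun i hi => H.vanP' i 5 hi (by decide)
  have Q4 : ∀ i, i ≠ 5 → P i 4 = 0 := fun i hi => by rw [H.antiP, P4 i hi, neg_zero]
  have Pm : ∀ i, P i m = 0 := fun i => by
    by_cases hi : i = 4
    · rw [hi, P4 m h5]
    · exact H.vanP' i m hi h4
  have h54 := H.antiP 5 4
  have : P 4 5 * (2 * α m + β m) = 0 := by
    have z := P4 0 (by decide)
    have z1 := P4 1 (by decide)
    have z2 := P4 2 (by decide)
    have z3 := P4 3 (by decide)
    have z4 := P4 4 (by decide)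
    have z6 := P4 6 (by decide)
    simp [P5, Q4, Pm, h54] at h
    fin_cases m <;> first | exact absurd rfl h4 | exact absurd rfl h5 |
      (simp [-mul_eq_zero] at h ⊢; linarith)
  exact (mul_eq_zero.1 this).resolve_left hp

theorem DiagEqs.alpha_zero (H : DiagEqs α β w v y u P V Y U) (hp : P 4 5 ≠ 0) (m : Fin 7)
    (h4 : m ≠ 4) (h5 : m ≠ 5) : α m = 0 ∧ β m = 0 := by
  have hf := H.trace_form hp
  have t0 := hf 0 (by decide) (by decide)
  have t1 := hf 1 (by decide) (by decide)
  have t2 := hf 2 (by decide) (by decide)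
  have t3 := hf 3 (by decide) (by decide)
  have a4 := H.eP m 4
  have b4 := H.eB m 4
  have a5 := H.eP m 5
  have b5 := H.eB m 5
  have a := H.eP 4 5
  have b := H.eB 4 5
  have p1 : P m 4 = 0 := by rw [H.antiP, H.vanP4 m h5, neg_zero]
  have p2 := H.vanP' m 5 h4 (by decide)
  have tm := hf m h4 h5
  rw [p1] at a4
  rw [p2] at a5
  simp only [sum_dstr, dact, Matrix.cons_val] at a4 b4 a5 b5 a b
  have e1 : (α m + β m) * (2 * α 4 + β 4) - w m * (2 * α 5 + β 5) = 0 := by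
    have t6 := hf 6 (by decide) (by decide)
    fin_cases m <;> first | exact absurd rfl h4 | exact absurd rfl h5 |
      (simp at a4 b4 a5 b5 tm ⊢; grind)
  have e2 : α m * (2 * α 5 + β 5) = 0 := by
    have t6 := hf 6 (by decide) (by decide)
    fin_cases m <;> first | exact absurd rfl h4 | exact absurd rfl h5 |
      (simp at a4 b4 a5 b5 tm ⊢; grind)
  have e3 : (α 5 + β 5) * (2 * α 4 + β 4) - (α 4 + w 5) * (2 * α 5 + β 5) = - 2 * P 4 5 := by
    grind
  have hα : α m = 0 := by
    by_contra hα
    have e4 := (mul_eq_zero.1 e2).resolve_left hα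
    have e5 : α m * (2 * α 4 + β 4) = 0 := by grind
    have e6 := (mul_eq_zero.1 e5).resolve_left hα
    rw [e4, e6] at e3
    exact hp (by linarith)
  exact ⟨hα, by linarith⟩

theorem DiagEqs.w_zero (H : DiagEqs α β w v y u P V Y U) (hp : P 4 5 ≠ 0) (m : Fin 7)
    (h4 : m ≠ 4) (h5 : m ≠ 5) : w m = 0 := by
  have a4 := H.eP m 4
  have b4 := H.eB m 4
  have a := H.eP 4 5
  rw [H.antiP, H.vanP4 m h5] at a4
  obtain ⟨a0, b0⟩ := H.alpha_zero hp 0 (by decide) (by decide)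
  obtain ⟨a1, b1⟩ := H.alpha_zero hp 1 (by decide) (by decide)
  obtain ⟨a2, b2⟩ := H.alpha_zero hp 2 (by decide) (by decide)
  obtain ⟨a3, b3⟩ := H.alpha_zero hp 3 (by decide) (by decide)
  obtain ⟨a6, b6⟩ := H.alpha_zero hp 6 (by decide) (by decide)
  obtain ⟨am, bm⟩ := H.alpha_zero hp m h4 h5
  simp only [sum_dstr, dact, Matrix.cons_val, a0, a1, a2, a3, b0, b1, b2, b3, am, bm] at a4 b4 a
  have e1 : w m * α 5 = 0 := by
    fin_cases m <;> first | exact absurd rfl h4 | exact absurd rfl h5 |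
      (simp [a0, a1, a2, a3, a6] at a4 ⊢; grind)
  have e2 : w m * β 5 = 0 := by
    fin_cases m <;> first | exact absurd rfl h4 | exact absurd rfl h5 |
      (simp [b0, b1, b2, b3, b6] at b4 ⊢; grind)
  by_contra hw
  have e3 := (mul_eq_zero.1 e1).resolve_left hw
  have e4 := (mul_eq_zero.1 e2).resolve_left hw
  exact hp (by rw [a, e3, e4]; ring)

end

section

variable {α β w v y u : Fin 7 → ℝ} {P V Y U : Fin 7 → Fin 7 → ℝ}

/-- There is no such connection with nonvanishing `A`-part of the curvature. -/
theorem DiagEqs.flat (H : DiagEqs α β w v y u P V Y U) : P 4 5 = 0 := by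
  by_contra hp
  obtain ⟨a0, b0⟩ := H.alpha_zero hp 0 (by decide) (by decide)
  obtain ⟨a1, b1⟩ := H.alpha_zero hp 1 (by decide) (by decide)
  obtain ⟨a2, b2⟩ := H.alpha_zero hp 2 (by decide) (by decide)
  obtain ⟨a3, b3⟩ := H.alpha_zero hp 3 (by decide) (by decide)
  obtain ⟨a6, b6⟩ := H.alpha_zero hp 6 (by decide) (by decide)
  have w0 := H.w_zero hp 0 (by decide) (by decide)
  have w1 := H.w_zero hp 1 (by decide) (by decide)
  have w2 := H.w_zero hp 2 (by decide) (by decide)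
  have w3 := H.w_zero hp 3 (by decide) (by decide)
  have w6 := H.w_zero hp 6 (by decide) (by decide)
  have sq : √2 ≠ 0 := by positivity
  obtain ⟨Y04, Y15, Y05, U05, Y06, U06, Y14, U04, U14⟩ := H.special
  have eV := H.eV
  have eY := H.eY
  have eU := H.eU
  have eP := H.eP 4 5
  have eB := H.eB 4 5
  have eW := H.eW 4 5
  simp only [sum_dstr] at eV eY eU eP eB eW
  have v0 : v 0 = 0 := by
    have h := eV 0 3
    rw [H.vanV 0 3 (by decide) (by decide)] at h
    simp [dact, a0, b0, w0, a3, b3, w3] at h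
    exact h
  have u0 : u 0 = 0 := by
    have h := eU 0 6
    rw [U06] at h
    simp [dact, a0, b0, w0, a6, b6, w6, v0] at h
    exact h
  rw [eY] at Y04 Y15 Y05 Y14
  rw [eU] at U14 U04
  simp [dact, a0, b0, w0, a1, b1, w1, a2, b2, w2, a3, b3, w3, a6, b6, w6, v0, u0]
    at Y04 Y15 Y05 Y14 U14 U04 eP eB eW
  have y0 : y 0 ≠ 0 := by
    rintro y0
    apply hp
    rw [← Y04, y0]; ring
  have y5 : y 0 = α 5 := by
    have : y 0 * (y 0 - α 5) = 0 := by linarith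
    linarith [(mul_eq_zero.1 this).resolve_left y0]
  have hv : ∀ i : Fin 7, i = 1 ∨ i = 2 → v i = 0 := by
    rintro i hi
    have h := eY i 3
    rw [(H.flat3 i (by tauto)).1] at h
    rcases hi with rfl | rfl <;>
    · simp [dact, a1, b1, w1, a2, b2, w2, a3, b3, w3, y0] at h
      exact h
  have v1 := hv 1 (by tauto)
  have v2 := hv 2 (by tauto)
  simp only [v1] at Y04 Y15 Y05 Y14 U14 U04 eP eB eW
  rw [y5] at y0
  have u1 := U04.resolve_left (y5 ▸ y0)
  rw [u1] at Y14
  rw [y5] at Y04 Y15 Y14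
  have b5 : β 5 = 2 * α 5 := by
    have : P 4 5 * (β 5 - 2 * α 5) = 0 := by
      linear_combination -β 5 * Y04 + α 5 * Y15 - α 5 * eP
    linarith [(mul_eq_zero.1 this).resolve_left hp]
  rw [b5] at eB eW eP
  have w5 : w 5 = α 4 - y 1 := by
    have : α 5 * (w 5 - (α 4 - y 1)) = 0 := by linear_combination - eP - Y04
    linarith [(mul_eq_zero.1 this).resolve_left y0]
  have b4 : 3 * β 4 = 2 * (α 4 + w 5) := by
    have : α 5 * (3 * β 4 - 2 * (α 4 + w 5)) = 0 := by linear_combination eB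
    linarith [(mul_eq_zero.1 this).resolve_left y0]
  rw [w5] at b4 eW
  have sq0 : (α 4 + y 1) ^ 2 = 0 := by
    grind
  have s0 := (pow_eq_zero_iff two_ne_zero).1 sq0
  exact hp (by rw [← Y04]; linear_combination - α 5 * s0)

end

section

variable {L : V7 →ₗ[ℝ] M7}

theorem dmat_comm_h3 (α β w v y u v' : ℝ) (z : Fin 2 → ℝ) :
    dmat α β w v y u * h3 0 v' z - h3 0 v' z * dmat α β w v y u
      = h3 0 ((α + β) * v') ![(2 * α + β) * z 0, (α + 2 * β) * z 1 + 3 * w * v'] := by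
  have := sq_two_mul
  ext i j
  simp only [Matrix.sub_apply, Matrix.mul_apply, Fin.sum_univ_seven]
  fin_cases i <;> fin_cases j <;> simp [dmat, h3, hmat] <;> grind

/-- The subspace `𝔪(1,0,2)`. -/
def m102sub : Submodule ℝ M7 where
  carrier := m102
  zero_mem' := ⟨0, 0, by ext i j; fin_cases i <;> fin_cases j <;> simp [h3, hmat]⟩
  add_mem' := by
    rintro _ _ ⟨v, y, rfl⟩ ⟨w, z, rfl⟩
    refine ⟨v + w, y + z, ?_⟩
    ext i j; fin_cases i <;> fin_cases j <;> simp [h3, hmat] <;> ring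
  smul_mem' := by
    rintro c _ ⟨v, y, rfl⟩
    refine ⟨c * v, c • y, ?_⟩
    ext i j; fin_cases i <;> fin_cases j <;> simp [h3, hmat] <;> ring

/-- The algebras `ℝ·diag(1,0) ⋉ 𝔪(1,0,k)` are not holonomy algebras. -/
theorem infHol_ne_rdiag10 {k : ℕ} (hk : k = 1 ∨ k = 2) (hjac : Jacobi L)
    (hL : ∀ x, L x ∈ g2star) : (infHol L (lieBr L) : Set M7) ≠ semidir rdiag10 k := by
  intro hhol
  have hd : ∀ x, L x = dmat (L x 1 1) (L x 2 2) (L x 5 4) (L x 1 6) (L x 1 4) (L x 2 4) := by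
    intro x
    obtain ⟨s, hs⟩ := hL x
    have h := Xg2_eq_dmat_of_normalizes hk (s := s) (by
      intro X hX
      rw [← hhol] at hX ⊢
      rw [hs]
      exact comm_mem_infHol hX x)
    rw [hs] at h
    rw [h]
    simp [dmat, hmat]
  have hc : ∀ x y, curv L (lieBr L) x y ∈ semidir rdiag10 k := fun x y =>
    hhol ▸ curv_mem_infHol L (lieBr L) x y
  have E := diagEqs hjac hd hc
  have hle : infHol L (lieBr L) ≤ m102sub := by
    refine sInf_le ⟨fun x y => ?_, ?_⟩
    · rw [curv_eq_sum]
      refine Submodule.sum_mem _ fun i _ => Submodule.sum_mem _ fun j _ =>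
        Submodule.smul_mem _ _ ⟨cv L i j 1 6, ![cv L i j 1 4, cv L i j 2 4], ?_⟩
      refine (entries_of_mem_semidir (hc (e i) (e j))).1.trans ?_
      have hP : curv L (lieBr L) (e i) (e j) 1 1 = 0 := E.vanP i j E.flat
      rw [hP]
      congr 1
      ext a b
      fin_cases a <;> fin_cases b <;> rfl
    · rintro z _ ⟨v, y, rfl⟩
      rw [hd z, dmat_comm_h3]
      exact ⟨_, _, rfl⟩
  have h1 : h3 !![1, 0; 0, 0] 0 ![0, 0] ∈ infHol L (lieBr L) := by
    rw [← SetLike.mem_coe, hhol]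
    rcases hk with rfl | rfl
    · exact ⟨_, ⟨1, rfl⟩, 0, 0, rfl⟩
    · exact ⟨_, ⟨1, rfl⟩, 0, _, rfl⟩
  obtain ⟨v, y, h⟩ := hle h1
  have := congrFun (congrFun h 1) 1
  simp [h3, hmat] at this

end

theorem stmt15 (bk : V7 → V7 → V7) (L : V7 →ₗ[ℝ] M7)
    (hbk : ∀ x y : V7, (L x).mulVec y - (L y).mulVec x = bk x y)
    (halt : ∀ x : V7, bk x x = 0)
    (hjac : ∀ x y z : V7, bk (bk x y) z + bk (bk y z) x + bk (bk z x) y = 0)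
    (hL : ∀ x, L x ∈ g2star)
    (a : Set M2) (k : ℕ) (hak : ListedPair a k) (ha : a ≠ ({0} : Set M2))
    (hhol : (infHol L bk : Set M7) = semidir a k) :
    (∀ x, L x ∈ hIII) ∧
    (∀ i j : Fin 7, i.val < 3 → j.val < 3 → bk (e i) (e j) = 0) := by
  obtain rfl : bk = lieBr L := by
    funext x y
    exact (hbk x y).symm
  have hstab : ∀ x, ∀ X ∈ semidir a k, L x * X - X * L x ∈ semidir a k := by
    intro x X hX
    rw [← hhol] at hX ⊢
    exact comm_mem_infHol hX x
  rcases hak with ⟨ha4, rfl⟩ | ⟨ha0 | rfl, hk⟩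
  · have key : ∀ x, L x ∈ hIII ∧ (a = dd → L x 1 2 = 0 ∧ L x 2 1 = 0) := by
      intro x
      obtain ⟨s, hs⟩ := hL x
      have h := hstab x
      rw [← hs] at h ⊢
      exact mem_hIII_of_normalizes ha4 h
    have hmem := fun x => (key x).1
    have mem : ∀ A ∈ a, ∀ v, h3 A v 0 ∈ infHol L (lieBr L) := fun A hA v => by
      rw [← SetLike.mem_coe, hhol]
      exact mem_semidir_two hA v 0
    refine ⟨hmem, lieBr_eq_zero hmem fun w hw => ?_⟩
    have irr : !![0, -1; 1, 0] ∈ a → (0 : M2) ∈ a → _ := fun hr h0 =>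
      (irredSetup_of_mem_infHol hmem hjac (mem _ hr 0) (mem 0 h0 1)).vanish w hw
    rcases ha4 with rfl | rfl | rfl | rfl
    · exact irr (by simp [sl2]) (by simp [sl2])
    · exact irr trivial trivial
    · exact irr ⟨0, 1, rfl⟩ ⟨0, 0, by ext i j; fin_cases i <;> fin_cases j <;> simp⟩
    · have hq := fun x => (key x).2 rfl
      obtain ⟨h1, h2⟩ := vanish_of_diagonal hmem hjac (fun x => (hq x).1) (fun x => (hq x).2)
        (mem _ (by simp [dd]) 0) (mem _ (by simp [dd]) 0) w (by omega)
      exact ⟨h1, (hq _).1, (hq _).2, h2⟩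
  · exact absurd ha0 ha
  · exact absurd hhol (infHol_ne_rdiag10 hk hjac hL)
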